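/- For every d ≥ 1, every 0 < h < d, every 0 ≤ s ≤ t ≤ d, and every β ∈ 𝒟(h,s,t,d), there exists a CIFS on ℝ^d all of whose maps are contracting similarity maps, with limit set Λ and fixed point set F, such that dim_H Λ = h, dim_LB F = s, dim_UB F = t, and dim_LB Λ = β. -/

import Mathlib

open Set Metric Filter Topology MeasureTheory

noncomputable section

/-- Least number of open balls of radius `r` needed to cover `E`. -/
def coveringNumber {α : Type*} [PseudoMetricSpace α] (E : Set α) (r : ℝ) : ℕ :=
  sInf {n : ℕ | ∃ t : Finset α, t.card = n ∧ E ⊆ ⋃ x ∈ t, Metric.ball x r}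

/-- `s_E(r) = log N_r(E) / log (1/r)`. -/
def sFun {α : Type*} [PseudoMetricSpace α] (E : Set α) (r : ℝ) : ℝ :=
  Real.log (coveringNumber E r) / Real.log (1 / r)

/-- Lower box dimension. -/
def dimLB {α : Type*} [PseudoMetricSpace α] (E : Set α) : ℝ :=
  Filter.liminf (fun r => sFun E r) (nhdsWithin (0 : ℝ) (Set.Ioi 0))

/-- Upper box dimension. -/
def dimUB {α : Type*} [PseudoMetricSpace α] (E : Set α) : ℝ :=
  Filter.limsup (fun r => sFun E r) (nhdsWithin (0 : ℝ) (Set.Ioi 0))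

/-- Upper right Dini derivative. -/
def upperDini (g : ℝ → ℝ) (x : ℝ) : ℝ :=
  Filter.limsup (fun h => (g (x + h) - g x) / h) (nhdsWithin (0 : ℝ) (Set.Ioi 0))

/-- The class `𝒢(λ, α)`. -/
def GClass (lam alp : ℝ) : Set (ℝ → ℝ) :=
  {g | Continuous g ∧ (∀ x, g x ∈ Set.Icc lam alp) ∧
    ∀ x, upperDini g x ∈ Set.Icc (lam - g x) (alp - g x)}

/-- Asymptotic equivalence of two functions. -/
def AsympEquiv (f g : ℝ → ℝ) : Prop :=
  Filter.Tendsto (fun x => f x - g x) Filter.atTop (nhds 0)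

/-- `E` has covering class `g`. -/
def HasCoveringClass {α : Type*} [PseudoMetricSpace α] (E : Set α) (g : ℝ → ℝ) : Prop :=
  AsympEquiv (fun x => sFun E (Real.exp (-Real.exp x))) g

/-- Composition of the maps indexed by a finite word. -/
def compMaps {α : Type*} {I : Type*} (T : I → α → α) : List I → α → α
  | [] => id
  | i :: w => T i ∘ compMaps T w

/-- A conformal iterated function system on `ℝ^d` satisfying the open set condition
and the cone condition. -/
structure CIFS (d : ℕ) where
  /-- the compact seed set -/
  X : Set (EuclideanSpace ℝ (Fin d))
  /-- the countable index set -/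
  I : Type
  /-- the contractions -/
  S : I → EuclideanSpace ℝ (Fin d) → EuclideanSpace ℝ (Fin d)
  hXcompact : IsCompact X
  hXconn : IsConnected X
  hXint : (interior X).Nonempty
  hIcount : Countable I
  hInonempty : Nonempty I
  hSmaps : ∀ i, Set.MapsTo (S i) X X
  /-- the uniform contraction ratio -/
  c : ℝ
  hc0 : 0 < c
  hc1 : c < 1
  hcontr : ∀ i, ∀ x ∈ X, ∀ y ∈ X,
    (x ≠ y → 0 < dist (S i x) (S i y)) ∧ dist (S i x) (S i y) ≤ c * dist x y
  /-- the open connected set on which the maps extend conformally -/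
  V : Set (EuclideanSpace ℝ (Fin d))
  hVopen : IsOpen V
  hVbdd : Bornology.IsBounded V
  hVconn : IsConnected V
  hXV : X ⊆ V
  /-- the conformal extensions -/
  T : I → EuclideanSpace ℝ (Fin d) → EuclideanSpace ℝ (Fin d)
  hTagree : ∀ i, ∀ x ∈ X, T i x = S i x
  hTmaps : ∀ i, Set.MapsTo (T i) V V
  hTinj : ∀ i, Set.InjOn (T i) V
  /-- the Hölder exponent in `C^{1+ε}` -/
  eps : ℝ
  heps : 0 < eps
  hTdiff : ∀ i, ContDiffOn ℝ 1 (T i) V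
  hTholder : ∀ i, ∃ C : ℝ, 0 < C ∧ ∀ x ∈ V, ∀ y ∈ V,
    ‖fderiv ℝ (T i) x - fderiv ℝ (T i) y‖ ≤ C * ‖x - y‖ ^ eps
  hTconf : ∀ i, ∀ x ∈ V, IsConformalMap (fderiv ℝ (T i) x)
  /-- the bounded distortion constant -/
  K : ℝ
  hK : 1 ≤ K
  hBD : ∀ w : List I, ∀ x ∈ V, ∀ y ∈ V,
    ‖fderiv ℝ (compMaps T w) x‖ ≤ K * ‖fderiv ℝ (compMaps T w) y‖
  hOSCin : ∀ i, S i '' interior X ⊆ interior X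
  hOSCdisj : ∀ i j, i ≠ j → Disjoint (S i '' interior X) (S j '' interior X)
  hCone : ∃ κ : ℝ, 0 < κ ∧ ∀ x ∈ X, ∀ r : ℝ, 0 < r → r < 1 →
    ENNReal.ofReal (κ * r ^ d) ≤ volume (Metric.ball x r ∩ interior X)

/-- The limit set (attractor) of a CIFS. -/
def CIFS.limitSet {d : ℕ} (Φ : CIFS d) : Set (EuclideanSpace ℝ (Fin d)) :=
  ⋃ γ : ℕ → Φ.I, ⋂ n : ℕ, compMaps Φ.S (List.ofFn fun k : Fin (n + 1) => γ k) '' Φ.X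

/-- The set of fixed points of the maps of a CIFS. -/
def CIFS.fixedPoints {d : ℕ} (Φ : CIFS d) : Set (EuclideanSpace ℝ (Fin d)) :=
  {x | x ∈ Φ.X ∧ ∃ i, Φ.S i x = x}

/-- `ρ(w) = sup_{x ∈ X} ‖S'_w(x)‖`. -/
def CIFS.rho {d : ℕ} (Φ : CIFS d) (w : List Φ.I) : ℝ :=
  sSup ((fun x => ‖fderiv ℝ (compMaps Φ.T w) x‖) '' Φ.X)

/-- `Ψ(r, θ) = (1 - θ)·dim_H Λ + θ·s_F(r^θ)`. -/
def CIFS.Psi {d : ℕ} (Φ : CIFS d) (r θ : ℝ) : ℝ :=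
  (1 - θ) * (dimH Φ.limitSet).toReal + θ * sFun Φ.fixedPoints (r ^ θ)

/-- `ψ(r) = max_{θ ∈ [0,1]} Ψ(r,θ)` (which equals the supremum over `θ ∈ (0,1]`,
since `Ψ(r,0)` is defined as the limit of `Ψ(r,θ)` as `θ → 0⁺`). -/
def CIFS.psi {d : ℕ} (Φ : CIFS d) (r : ℝ) : ℝ :=
  sSup (Φ.Psi r '' Set.Ioc (0 : ℝ) 1)

/-- The interval `𝒟(h, s, t, α)`. -/
def Dset (h s t α : ℝ) : Set ℝ :=
  if t ≤ h then {h}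
  else Set.Icc (max h s) (h + (t - h) * (α - h) * s / (α * t - h * s))

/-- The quantity whose limit as `θ → 1⁻` is the quasi-Assouad dimension. -/
def quasiAssouadAux {α : Type*} [PseudoMetricSpace α] (E : Set α) (θ : ℝ) : ℝ :=
  sInf {t : ℝ | 0 ≤ t ∧ ∃ C : ℝ, 0 < C ∧ ∀ x ∈ E, ∀ r R : ℝ,
    0 < r → r ≤ R ^ (1 / θ) → R ^ (1 / θ) ≤ R → R < 1 →
    (coveringNumber (E ∩ Metric.ball x R) r : ℝ) ≤ C * (R / r) ^ t}

/-- The quasi-Assouad dimension. -/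
def dimqA {α : Type*} [PseudoMetricSpace α] (E : Set α) : ℝ :=
  Filter.limsup (quasiAssouadAux E) (nhdsWithin (1 : ℝ) (Set.Iio 1))

/-- The modified lower box dimension. -/
def dimLMB {α : Type*} [PseudoMetricSpace α] (K : Set α) : ℝ :=
  sInf {s : ℝ | ∃ C : ℕ → Set α, (K ⊆ ⋃ i, C i) ∧
    (∀ i, (C i).Nonempty ∧ Bornology.IsBounded (C i)) ∧ s = ⨆ i, dimLB (C i)}

/-- The unit cube `[0,1]^d`. -/
def unitCube (d : ℕ) : Set (EuclideanSpace ℝ (Fin d)) :=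
  {x | ∀ j, x j ∈ Set.Icc (0 : ℝ) 1}

/-- The basic similarity maps in the homogeneous Moran construction. -/
def moranMap (d : ℕ) (r : ℝ) (i : Fin d → Bool)
    (x : EuclideanSpace ℝ (Fin d)) : EuclideanSpace ℝ (Fin d) :=
  (EuclideanSpace.equiv (Fin d) ℝ).symm (fun j => r * x j + (if i j then 1 - r else 0))

/-- The `n`-th level of the homogeneous Moran construction. -/
def moranLevel (d : ℕ) : (ℕ → ℝ) → ℕ → Set (EuclideanSpace ℝ (Fin d))
  | _, 0 => unitCube d
  | r, n + 1 => ⋃ i : Fin d → Bool, moranMap d (r 1) i '' moranLevel d (fun k => r (k + 1)) n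

/-- The homogeneous Moran set `M(r)`. -/
def moranSet (d : ℕ) (r : ℕ → ℝ) : Set (EuclideanSpace ℝ (Fin d)) :=
  ⋂ n, moranLevel d r (n + 1)

/-- The Gauss map `x ↦ 1/x - ⌊1/x⌋`. -/
def gaussMap (x : ℝ) : ℝ := Int.fract (1 / x)

/-- The `n`-th partial quotient (continued fraction digit) of `x` (`n = 0` gives `b₁ = ⌊1/x⌋`). -/
def cfDigit (x : ℝ) (n : ℕ) : ℤ := ⌊1 / gaussMap^[n] x⌋

/-- The set of irrationals in `(0,1)` all of whose continued fraction digits lie in `I`. -/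
def cfSet (I : Set ℕ) : Set ℝ :=
  {x | x ∈ Set.Ioo (0 : ℝ) 1 ∧ Irrational x ∧ ∀ n : ℕ, ∃ b ∈ I, cfDigit x n = (b : ℤ)}

/-! ### Covering numbers -/

section Covering

variable {α : Type*} [PseudoMetricSpace α]

theorem coveringNumber_le_card {E : Set α} {r : ℝ} (t : Finset α)
    (h : E ⊆ ⋃ x ∈ t, ball x r) : coveringNumber E r ≤ t.card :=
  Nat.sInf_le ⟨t, rfl, h⟩

theorem exists_cover_card_eq [ProperSpace α] {E : Set α} {r : ℝ}
    (hE : Bornology.IsBounded E) (hr : 0 < r) :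
    ∃ t : Finset α, t.card = coveringNumber E r ∧ E ⊆ ⋃ x ∈ t, ball x r := by
  refine Nat.sInf_mem (s := {n : ℕ | ∃ t : Finset α, t.card = n ∧ E ⊆ ⋃ x ∈ t, ball x r}) ?_
  have htb : TotallyBounded E := hE.isCompact_closure.totallyBounded.subset subset_closure
  obtain ⟨t, htf, ht⟩ := Metric.totallyBounded_iff.1 htb r hr
  exact ⟨_, htf.toFinset, rfl, by simpa using ht⟩

theorem coveringNumber_mono [ProperSpace α] {E E' : Set α} {r : ℝ}
    (hE' : Bornology.IsBounded E') (hr : 0 < r) (h : E ⊆ E') :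
    coveringNumber E r ≤ coveringNumber E' r := by
  obtain ⟨t, ht, hc⟩ := exists_cover_card_eq hE' hr
  exact ht ▸ coveringNumber_le_card t (h.trans hc)

theorem coveringNumber_anti [ProperSpace α] {E : Set α} {r r' : ℝ}
    (hE : Bornology.IsBounded E) (hr : 0 < r) (h : r ≤ r') :
    coveringNumber E r' ≤ coveringNumber E r := by
  obtain ⟨t, ht, hc⟩ := exists_cover_card_eq hE hr
  exact ht ▸ coveringNumber_le_card t
    (hc.trans (iUnion₂_mono fun x _ => ball_subset_ball h))

theorem coveringNumber_union_le [ProperSpace α] {E E' : Set α} {r : ℝ}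
    (hE : Bornology.IsBounded E) (hE' : Bornology.IsBounded E') (hr : 0 < r) :
    coveringNumber (E ∪ E') r ≤ coveringNumber E r + coveringNumber E' r := by
  classical
  obtain ⟨t, ht, hc⟩ := exists_cover_card_eq hE hr
  obtain ⟨t', ht', hc'⟩ := exists_cover_card_eq hE' hr
  rw [← ht, ← ht']
  refine (coveringNumber_le_card (t ∪ t') ?_).trans (Finset.card_union_le t t')
  rw [Finset.set_biUnion_union]
  exact union_subset_union hc hc'

theorem coveringNumber_biUnion_le [ProperSpace α] {ι : Type*} (J : Finset ι) (E : ι → Set α)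
    {r : ℝ} (hE : ∀ i ∈ J, Bornology.IsBounded (E i)) (hr : 0 < r) :
    coveringNumber (⋃ i ∈ J, E i) r ≤ ∑ i ∈ J, coveringNumber (E i) r := by
  classical
  induction J using Finset.induction_on with
  | empty => simpa using coveringNumber_le_card (E := (∅ : Set α)) (r := r) ∅ (by simp)
  | insert a J ha ih =>
    rw [Finset.set_biUnion_insert, Finset.sum_insert ha]
    have hb : ∀ i ∈ J, Bornology.IsBounded (E i) := fun i hi =>
      hE i (Finset.mem_insert_of_mem hi)
    refine (coveringNumber_union_le (hE a (Finset.mem_insert_self a J)) ?_ hr).trans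
      (Nat.add_le_add_left (ih hb) _)
    exact (Bornology.isBounded_biUnion_finset J).2 hb

theorem one_le_coveringNumber [ProperSpace α] {E : Set α} {r : ℝ}
    (hE : Bornology.IsBounded E) (hne : E.Nonempty) (hr : 0 < r) : 1 ≤ coveringNumber E r := by
  obtain ⟨t, ht, hc⟩ := exists_cover_card_eq hE hr
  rw [← ht, Nat.one_le_iff_ne_zero, Finset.card_ne_zero]
  obtain ⟨x, hx⟩ := hne
  obtain ⟨y, hy, -⟩ := mem_iUnion₂.1 (hc hx)
  exact ⟨y, hy⟩

theorem coveringNumber_le_one {E : Set α} {r : ℝ} (x : α) (h : E ⊆ ball x r) :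
    coveringNumber E r ≤ 1 := by
  simpa using coveringNumber_le_card (E := E) (r := r) {x} (by simpa using h)

/-- Sets at pairwise distance at least `2 * r` have additive covering numbers. -/
theorem sum_coveringNumber_le [ProperSpace α] {ι : Type*} (J : Finset ι) (E : ι → Set α)
    {A : Set α} {r : ℝ} (hA : Bornology.IsBounded A) (hr : 0 < r) (hEA : ∀ i ∈ J, E i ⊆ A)
    (hsep : ∀ i ∈ J, ∀ j ∈ J, i ≠ j → ∀ x ∈ E i, ∀ y ∈ E j, 2 * r ≤ dist x y) :
    ∑ i ∈ J, coveringNumber (E i) r ≤ coveringNumber A r := by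
  classical
  obtain ⟨t, ht, hc⟩ := exists_cover_card_eq hA hr
  let u : ι → Finset α := fun i => t.filter fun x => (E i ∩ ball x r).Nonempty
  have hu : ∀ i ∈ J, coveringNumber (E i) r ≤ (u i).card := fun i hi => by
    refine coveringNumber_le_card _ fun x hx => ?_
    obtain ⟨y, hy, hxy⟩ := mem_iUnion₂.1 (hc (hEA i hi hx))
    exact mem_iUnion₂.2 ⟨y, Finset.mem_filter.2 ⟨hy, x, hx, hxy⟩, hxy⟩
  have hdis : (J : Set ι).PairwiseDisjoint u := by
    intro i hi j hj hij
    refine Finset.disjoint_left.2 fun x hx hx' => ?_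
    obtain ⟨-, y, hy, hyx⟩ := Finset.mem_filter.1 hx
    obtain ⟨-, z, hz, hzx⟩ := Finset.mem_filter.1 hx'
    have h1 := hsep i hi j hj hij y hy z hz
    have h2 := dist_triangle_right y z x
    rw [mem_ball] at hyx hzx
    linarith
  calc ∑ i ∈ J, coveringNumber (E i) r ≤ ∑ i ∈ J, (u i).card := Finset.sum_le_sum hu
    _ = (J.biUnion u).card := (Finset.card_biUnion hdis).symm
    _ ≤ t.card := Finset.card_le_card (Finset.biUnion_subset.2 fun i _ => Finset.filter_subset _ _)
    _ = _ := ht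

theorem card_le_coveringNumber [ProperSpace α] {ι : Type*} [Fintype ι] (f : ι → α)
    {A : Set α} {r : ℝ} (hA : Bornology.IsBounded A) (hr : 0 < r) (hf : ∀ i, f i ∈ A)
    (hsep : ∀ i j, i ≠ j → 2 * r ≤ dist (f i) (f j)) :
    Fintype.card ι ≤ coveringNumber A r := by
  refine le_trans ?_ (sum_coveringNumber_le Finset.univ (fun i => {f i}) hA hr
    (fun i _ => by simpa using hf i) fun i _ j _ hij x hx y hy => ?_)
  · rw [Fintype.card, Finset.card_eq_sum_ones]
    exact Finset.sum_le_sum fun i _ =>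
      one_le_coveringNumber Bornology.isBounded_singleton (singleton_nonempty _) hr
  · rw [mem_singleton_iff.1 hx, mem_singleton_iff.1 hy]
    exact hsep i j hij

/-- A map scaling distances by `ρ` maps covers at scale `r` to covers at scale `ρ r`. -/
theorem coveringNumber_image_le [ProperSpace α] {E : Set α} {r ρ : ℝ} {f : α → α}
    (hE : Bornology.IsBounded E) (hr : 0 < r) (hρ : 0 < ρ)
    (hf : ∀ x y, dist (f x) (f y) = ρ * dist x y) :
    coveringNumber (f '' E) (ρ * r) ≤ coveringNumber E r := by
  classical
  obtain ⟨t, ht, hc⟩ := exists_cover_card_eq hE hr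
  refine (coveringNumber_le_card (t.image f) ?_).trans (Finset.card_image_le.trans_eq ht)
  rintro _ ⟨x, hx, rfl⟩
  obtain ⟨y, hy, hxy⟩ := mem_iUnion₂.1 (hc hx)
  refine mem_iUnion₂.2 ⟨f y, Finset.mem_image_of_mem f hy, ?_⟩
  rw [mem_ball, hf]
  exact mul_lt_mul_of_pos_left hxy hρ

end Covering

/-! ### Systems of homotheties with separated fixed points -/

/-- Countably many fixed points in the unit ball, with contraction ratios that are small compared
to the distances between fixed points. -/
structure SeparatedSystem (d : ℕ) where
  /-- the index set -/
  I : Type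
  countable : Countable I
  nonempty : Nonempty I
  /-- the fixed points -/
  p : I → EuclideanSpace ℝ (Fin d)
  /-- the contraction ratios -/
  ρ : I → ℝ
  norm_p_le : ∀ i, ‖p i‖ ≤ 1
  ρ_pos : ∀ i, 0 < ρ i
  ρ_le : ∀ i, ρ i ≤ 1 / 16
  sep : ∀ i j, i ≠ j → 16 * ρ i ≤ dist (p i) (p j)

namespace SeparatedSystem

variable {d : ℕ} (A : SeparatedSystem d)

/-- The homothety with centre `p i` and ratio `ρ i`. -/
def map (i : A.I) (x : EuclideanSpace ℝ (Fin d)) : EuclideanSpace ℝ (Fin d) :=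
  A.p i + A.ρ i • (x - A.p i)

/-- The inverse of `map i`. -/
def invMap (i : A.I) (x : EuclideanSpace ℝ (Fin d)) : EuclideanSpace ℝ (Fin d) :=
  A.p i + (A.ρ i)⁻¹ • (x - A.p i)

theorem dist_map (i : A.I) (x y : EuclideanSpace ℝ (Fin d)) :
    dist (A.map i x) (A.map i y) = A.ρ i * dist x y := by
  rw [map, map, dist_add_left, dist_smul₀, dist_sub_right, Real.norm_of_nonneg (A.ρ_pos i).le]

theorem dist_invMap (i : A.I) (x y : EuclideanSpace ℝ (Fin d)) :
    dist (A.invMap i x) (A.invMap i y) = (A.ρ i)⁻¹ * dist x y := by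
  rw [invMap, invMap, dist_add_left, dist_smul₀, dist_sub_right,
    Real.norm_of_nonneg (inv_pos.2 (A.ρ_pos i)).le]

theorem invMap_map (i : A.I) (x : EuclideanSpace ℝ (Fin d)) : A.invMap i (A.map i x) = x := by
  simp [invMap, map, smul_smul, (A.ρ_pos i).ne']

theorem map_injective (i : A.I) : Function.Injective (A.map i) :=
  Function.LeftInverse.injective (A.invMap_map i)

theorem map_p (i : A.I) : A.map i (A.p i) = A.p i := by simp [map]

theorem map_eq_self_iff (i : A.I) (x : EuclideanSpace ℝ (Fin d)) :
    A.map i x = x ↔ x = A.p i := by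
  refine ⟨fun h => ?_, fun h => h ▸ A.map_p i⟩
  have h1 := A.dist_map i x (A.p i)
  rw [h, A.map_p] at h1
  have h2 := A.ρ_le i
  by_contra hne
  have h3 := dist_pos.2 hne
  nlinarith

theorem norm_map_le (i : A.I) (x : EuclideanSpace ℝ (Fin d)) :
    ‖A.map i x‖ ≤ (1 - A.ρ i) + A.ρ i * ‖x‖ := by
  have h : A.map i x = (1 - A.ρ i) • A.p i + A.ρ i • x := by
    rw [map]; module
  rw [h]
  have h1 := A.ρ_le i
  refine (norm_add_le _ _).trans ?_
  rw [norm_smul, norm_smul, Real.norm_of_nonneg (A.ρ_pos i).le,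
    Real.norm_of_nonneg (by linarith)]
  nlinarith [A.norm_p_le i]

theorem dist_map_p_le (i : A.I) {x : EuclideanSpace ℝ (Fin d)} (hx : x ∈ closedBall 0 1) :
    dist (A.map i x) (A.p i) ≤ 2 * A.ρ i := by
  have h := A.dist_map i x (A.p i)
  rw [A.map_p] at h
  rw [h]
  have h1 : dist x (A.p i) ≤ 2 := by
    rw [dist_eq_norm]
    rw [mem_closedBall_zero_iff] at hx
    linarith [norm_sub_le x (A.p i), A.norm_p_le i]
  nlinarith [A.ρ_pos i]

theorem le_dist_map {i j : A.I} (hij : i ≠ j) {x y : EuclideanSpace ℝ (Fin d)}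
    (hx : x ∈ closedBall 0 1) (hy : y ∈ closedBall 0 1) :
    8 * A.ρ i ≤ dist (A.map i x) (A.map j y) := by
  have h1 := A.dist_map_p_le i hx
  have h2 := A.dist_map_p_le j hy
  have h3 := A.sep i j hij
  have h4 := A.sep j i hij.symm
  have h5 := dist_triangle4 (A.p i) (A.map i x) (A.map j y) (A.p j)
  rw [dist_comm (A.p j)] at h4
  rw [dist_comm (A.p i) (A.map i x)] at h5
  linarith [A.ρ_pos i]

theorem fderiv_map (i : A.I) (x : EuclideanSpace ℝ (Fin d)) :
    HasFDerivAt (A.map i) (A.ρ i • ContinuousLinearMap.id ℝ (EuclideanSpace ℝ (Fin d))) x :=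
  (((hasFDerivAt_id x).sub_const (A.p i)).const_smul (A.ρ i)).const_add (A.p i)

theorem contDiff_map (i : A.I) : ContDiff ℝ 1 (A.map i) := by
  unfold map
  fun_prop

theorem fderiv_compMaps (w : List A.I) : ∃ c : ℝ, ∀ x,
    HasFDerivAt (compMaps A.map w) (c • ContinuousLinearMap.id ℝ (EuclideanSpace ℝ (Fin d))) x := by
  induction w with
  | nil => exact ⟨1, fun x => by simpa [compMaps] using hasFDerivAt_id x⟩
  | cons i w ih =>
    obtain ⟨c, hc⟩ := ih
    refine ⟨A.ρ i * c, fun x => ?_⟩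
    have h := (A.fderiv_map i (compMaps A.map w x)).comp x (hc x)
    rwa [show (A.ρ i • ContinuousLinearMap.id ℝ (EuclideanSpace ℝ (Fin d))) ∘SL
        (c • ContinuousLinearMap.id ℝ (EuclideanSpace ℝ (Fin d))) =
        (A.ρ i * c) • ContinuousLinearMap.id ℝ (EuclideanSpace ℝ (Fin d)) by
      ext v
      simp only [ContinuousLinearMap.comp_apply, _root_.smul_apply,
        ContinuousLinearMap.id_apply, smul_smul]] at h

theorem exists_cone (d : ℕ) : ∃ κ : ℝ, 0 < κ ∧
    ∀ x ∈ closedBall (0 : EuclideanSpace ℝ (Fin d)) 1, ∀ r : ℝ, 0 < r → r < 1 →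
      ENNReal.ofReal (κ * r ^ d) ≤ volume (ball x r ∩ ball 0 1) := by
  have hv0 : 0 < volume (ball (0 : EuclideanSpace ℝ (Fin d)) 1) :=
    measure_ball_pos _ _ one_pos
  have hv1 : volume (ball (0 : EuclideanSpace ℝ (Fin d)) 1) ≠ ⊤ := measure_ball_lt_top.ne
  refine ⟨(1 / 2) ^ d * (volume (ball (0 : EuclideanSpace ℝ (Fin d)) 1)).toReal,
    mul_pos (by positivity) (ENNReal.toReal_pos hv0.ne' hv1), fun x hx r hr hr1 => ?_⟩
  rw [mem_closedBall_zero_iff] at hx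
  have hsub : ball ((1 - r / 2) • x) (r / 2) ⊆ ball x r ∩ ball 0 1 := by
    intro y hy
    rw [mem_ball, dist_eq_norm] at hy
    have h1 : ‖(1 - r / 2) • x‖ ≤ 1 - r / 2 := by
      rw [norm_smul, Real.norm_of_nonneg (by linarith)]
      nlinarith
    have h2 : ‖(1 - r / 2) • x - x‖ ≤ r / 2 := by
      have : (1 - r / 2) • x - x = (-(r / 2)) • x := by module
      rw [this, norm_smul, norm_neg, Real.norm_of_nonneg (by linarith)]
      nlinarith
    constructor
    · rw [mem_ball, dist_eq_norm]
      calc ‖y - x‖ = ‖(y - (1 - r / 2) • x) + ((1 - r / 2) • x - x)‖ := by congr 1; abel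
        _ ≤ _ := norm_add_le _ _
        _ < r := by linarith
    · rw [mem_ball_zero_iff]
      calc ‖y‖ = ‖(y - (1 - r / 2) • x) + (1 - r / 2) • x‖ := by congr 1; abel
        _ ≤ _ := norm_add_le _ _
        _ < 1 := by linarith
  refine le_trans ?_ (measure_mono hsub)
  rw [Measure.addHaar_ball_of_pos _ ((1 - r / 2) • x) (by positivity), finrank_euclideanSpace_fin]
  rw [show (1 / 2) ^ d * (volume (ball (0 : EuclideanSpace ℝ (Fin d)) 1)).toReal * r ^ d
    = (r / 2) ^ d * (volume (ball (0 : EuclideanSpace ℝ (Fin d)) 1)).toReal by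
      rw [div_pow, div_pow]; ring]
  rw [ENNReal.ofReal_mul (by positivity), ENNReal.ofReal_toReal hv1]

/-- The CIFS on the closed unit ball given by a separated system. -/
def toCIFS : CIFS d where
  X := closedBall 0 1
  I := A.I
  S := A.map
  hXcompact := isCompact_closedBall 0 1
  hXconn := (convex_closedBall 0 1).isConnected ⟨0, by simp⟩
  hXint := by
    rw [interior_closedBall _ one_ne_zero]
    exact ⟨0, by simp⟩
  hIcount := A.countable
  hInonempty := A.nonempty
  hSmaps := fun i x hx => by
    rw [mem_closedBall_zero_iff] at hx ⊢
    nlinarith [A.norm_map_le i x, A.ρ_pos i]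
  c := 1 / 16
  hc0 := by norm_num
  hc1 := by norm_num
  hcontr := fun i x _ y _ => by
    rw [A.dist_map]
    exact ⟨fun h => mul_pos (A.ρ_pos i) (dist_pos.2 h),
      mul_le_mul_of_nonneg_right (A.ρ_le i) dist_nonneg⟩
  V := ball 0 2
  hVopen := isOpen_ball
  hVbdd := isBounded_ball
  hVconn := (convex_ball 0 2).isConnected ⟨0, by simp⟩
  hXV := closedBall_subset_ball (by norm_num)
  T := A.map
  hTagree := fun _ _ _ => rfl
  hTmaps := fun i x hx => by
    rw [mem_ball_zero_iff] at hx ⊢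
    nlinarith [A.norm_map_le i x, A.ρ_pos i, A.ρ_le i]
  hTinj := fun i => (A.map_injective i).injOn
  eps := 1
  heps := one_pos
  hTdiff := fun i => (A.contDiff_map i).contDiffOn
  hTholder := fun i => ⟨1, one_pos, fun x _ y _ => by
    rw [(A.fderiv_map i x).fderiv, (A.fderiv_map i y).fderiv, sub_self, norm_zero]
    positivity⟩
  hTconf := fun i x _ => by
    rw [(A.fderiv_map i x).fderiv]
    exact isConformalMap_const_smul (A.ρ_pos i).ne'
  K := 1
  hK := le_rfl
  hBD := fun w x _ y _ => by
    obtain ⟨c, hc⟩ := A.fderiv_compMaps w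
    rw [(hc x).fderiv, (hc y).fderiv, one_mul]
  hOSCin := fun i => by
    rw [interior_closedBall _ one_ne_zero]
    rintro _ ⟨x, hx, rfl⟩
    rw [mem_ball_zero_iff] at hx ⊢
    nlinarith [A.norm_map_le i x, A.ρ_pos i]
  hOSCdisj := fun i j hij => by
    rw [Set.disjoint_left]
    rintro _ ⟨x, hx, rfl⟩ ⟨y, hy, hxy⟩
    have h := A.le_dist_map hij (interior_subset hx) (interior_subset hy)
    rw [hxy, dist_self] at h
    linarith [A.ρ_pos i]
  hCone := by
    rw [interior_closedBall _ one_ne_zero]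
    exact exists_cone d

theorem fixedPoints_toCIFS : A.toCIFS.fixedPoints = range A.p := by
  ext x
  constructor
  · rintro ⟨-, i, hi⟩
    exact ⟨i, ((A.map_eq_self_iff i x).1 hi).symm⟩
  · rintro ⟨i, rfl⟩
    exact ⟨mem_closedBall_zero_iff.2 (A.norm_p_le i), i, A.map_p i⟩

/-- The limit set of a separated system. -/
def Λ : Set (EuclideanSpace ℝ (Fin d)) := A.toCIFS.limitSet

theorem mem_Λ {x : EuclideanSpace ℝ (Fin d)} : x ∈ A.Λ ↔ ∃ γ : ℕ → A.I, ∀ n : ℕ,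
    x ∈ compMaps A.map (List.ofFn fun k : Fin (n + 1) => γ k) '' closedBall 0 1 := by
  unfold Λ CIFS.limitSet
  simp only [mem_iUnion, mem_iInter]
  rfl

theorem compMaps_mapsTo (w : List A.I) :
    MapsTo (compMaps A.map w) (closedBall 0 1) (closedBall 0 1) := by
  induction w with
  | nil => exact mapsTo_id _
  | cons i w ih => exact (A.toCIFS.hSmaps i).comp ih

theorem Λ_subset : A.Λ ⊆ closedBall 0 1 := fun x hx => by
  obtain ⟨γ, hγ⟩ := A.mem_Λ.1 hx
  obtain ⟨y, hy, rfl⟩ := hγ 0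
  exact A.compMaps_mapsTo _ hy

theorem isBounded_Λ : Bornology.IsBounded A.Λ := isBounded_closedBall.subset A.Λ_subset

theorem compMaps_ofFn_succ (γ : ℕ → A.I) (n : ℕ) :
    compMaps A.map (List.ofFn fun k : Fin (n + 1) => γ k) =
      A.map (γ 0) ∘ compMaps A.map (List.ofFn fun k : Fin n => γ (k + 1)) := by
  rw [List.ofFn_succ]
  rfl

theorem map_image_Λ_subset (i : A.I) : A.map i '' A.Λ ⊆ A.Λ := by
  rintro _ ⟨y, hy, rfl⟩
  obtain ⟨γ, hγ⟩ := A.mem_Λ.1 hy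
  refine A.mem_Λ.2 ⟨fun n => Nat.casesOn n i γ, fun n => ?_⟩
  rw [A.compMaps_ofFn_succ, image_comp]
  refine mem_image_of_mem _ ?_
  cases n with
  | zero => simpa [compMaps] using A.Λ_subset hy
  | succ n => exact hγ n

theorem Λ_subset_iUnion : A.Λ ⊆ ⋃ i, A.map i '' A.Λ := by
  intro x hx
  obtain ⟨γ, hγ⟩ := A.mem_Λ.1 hx
  obtain ⟨y, -, hy⟩ := hγ 0
  rw [A.compMaps_ofFn_succ] at hy
  refine mem_iUnion.2 ⟨γ 0, _, A.mem_Λ.2 ⟨fun n => γ (n + 1), fun n => ?_⟩, hy⟩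
  obtain ⟨z, hz, hzx⟩ := hγ (n + 1)
  rw [A.compMaps_ofFn_succ] at hzx
  rw [← A.map_injective _ (hzx.trans hy.symm)]
  exact mem_image_of_mem _ hz

theorem range_p_subset_Λ : range A.p ⊆ A.Λ := by
  rintro _ ⟨i, rfl⟩
  refine A.mem_Λ.2 ⟨fun _ => i, fun n => ⟨A.p i, mem_closedBall_zero_iff.2 (A.norm_p_le i), ?_⟩⟩
  generalize n + 1 = m
  induction m with
  | zero => rfl
  | succ m ih =>
    rw [A.compMaps_ofFn_succ (fun _ => i), Function.comp_apply, ih, A.map_p]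

/-! ### Covering numbers of the limit set -/

theorem coveringNumber_Λ_step {q : ℝ} (hq : 0 < q) (J : Finset A.I)
    (hJ : ∀ i, i ∉ J → A.ρ i ≤ q / 4) :
    coveringNumber A.Λ q ≤
      coveringNumber (range A.p) (q / 4) + ∑ i ∈ J, coveringNumber A.Λ (q / A.ρ i) := by
  have hbF : Bornology.IsBounded (range A.p) := A.isBounded_Λ.subset A.range_p_subset_Λ
  have hbi : ∀ i, Bornology.IsBounded (A.map i '' A.Λ) := fun i =>
    A.isBounded_Λ.subset (A.map_image_Λ_subset i)
  have hb1 : Bornology.IsBounded (⋃ i ∈ {i | i ∉ J}, A.map i '' A.Λ) :=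
    A.isBounded_Λ.subset (iUnion₂_subset fun i _ => A.map_image_Λ_subset i)
  have hb2 : Bornology.IsBounded (⋃ i ∈ J, A.map i '' A.Λ) :=
    A.isBounded_Λ.subset (iUnion₂_subset fun i _ => A.map_image_Λ_subset i)
  have hsub : A.Λ ⊆ (⋃ i ∈ {i | i ∉ J}, A.map i '' A.Λ) ∪ ⋃ i ∈ J, A.map i '' A.Λ := by
    intro x hx
    obtain ⟨i, hi⟩ := mem_iUnion.1 (A.Λ_subset_iUnion hx)
    by_cases h : i ∈ J
    · exact Or.inr (mem_iUnion₂.2 ⟨i, h, hi⟩)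
    · exact Or.inl (mem_iUnion₂.2 ⟨i, h, hi⟩)
  refine (coveringNumber_mono (hb1.union hb2) hq hsub).trans
    ((coveringNumber_union_le hb1 hb2 hq).trans (add_le_add ?_ ?_))
  · obtain ⟨t, ht, hc⟩ := exists_cover_card_eq hbF (by positivity : 0 < q / 4)
    rw [← ht]
    refine coveringNumber_le_card t (iUnion₂_subset fun i hi => ?_)
    rintro _ ⟨x, hx, rfl⟩
    obtain ⟨y, hy, hpy⟩ := mem_iUnion₂.1 (hc (mem_range_self i))
    refine mem_iUnion₂.2 ⟨y, hy, ?_⟩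
    rw [mem_ball] at hpy ⊢
    linarith [dist_triangle (A.map i x) (A.p i) y, A.dist_map_p_le i (A.Λ_subset hx), hJ i hi]
  · refine (coveringNumber_biUnion_le J _ (fun i _ => hbi i) hq).trans
      (Finset.sum_le_sum fun i _ => ?_)
    have h := coveringNumber_image_le A.isBounded_Λ (div_pos hq (A.ρ_pos i)) (A.ρ_pos i)
      (A.dist_map i)
    rwa [mul_div_cancel₀ _ (A.ρ_pos i).ne'] at h

theorem finite_lt_ρ {h q : ℝ} (hh : 0 < h) (hsum : Summable fun i => A.ρ i ^ h) (hq : 0 < q) :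
    {i | q < A.ρ i}.Finite := by
  have h1 := hsum.tendsto_cofinite_zero.eventually (gt_mem_nhds (Real.rpow_pos_of_pos hq h))
  refine (Filter.eventually_cofinite.1 h1).subset fun i hi => ?_
  exact not_lt.2 (Real.rpow_le_rpow hq.le (le_of_lt hi) hh.le)

/-- Upper bound for the covering numbers of the limit set through those of the fixed points. -/
theorem coveringNumber_Λ_le {h r₀ W : ℝ} (hh : 0 < h) (hsum : HasSum (fun i => A.ρ i ^ h) 1)
    (hr₀ : 0 < r₀)
    (hW : ∀ τ, r₀ / 4 < τ → τ ≤ 1 →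
      (coveringNumber (range A.p) (r₀ / τ / 4) : ℝ) ≤ τ ^ h * W) (n : ℕ) :
    ∀ τ, r₀ / 4 < τ → τ ≤ 1 → 2 * (1 / 16) ^ n ≤ r₀ / τ →
      (coveringNumber A.Λ (r₀ / τ) : ℝ) ≤ (n + 1) * (τ ^ h * W) := by
  have hbF : Bornology.IsBounded (range A.p) := A.isBounded_Λ.subset A.range_p_subset_Λ
  have hne : (range A.p).Nonempty := by
    have := A.nonempty
    exact range_nonempty _
  induction n with
  | zero =>
    intro τ h1 h2 h3
    have hτ : 0 < τ := by linarith
    have h4 : (1 : ℝ) ≤ coveringNumber (range A.p) (r₀ / τ / 4) := by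
      exact_mod_cast one_le_coveringNumber hbF hne (by positivity)
    have h5 : (coveringNumber A.Λ (r₀ / τ) : ℝ) ≤ 1 := by
      exact_mod_cast coveringNumber_le_one 0
        (A.Λ_subset.trans (closedBall_subset_ball (by norm_num at h3; linarith)))
    have := hW τ h1 h2
    push_cast
    linarith
  | succ n ih =>
    intro τ h1 h2 h3
    have hτ : 0 < τ := by linarith
    have hq : 0 < r₀ / τ := by positivity
    have hfin := A.finite_lt_ρ hh hsum.summable (by positivity : 0 < r₀ / τ / 4)
    have hstep := A.coveringNumber_Λ_step hq hfin.toFinset (fun i hi => by simpa using hi)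
    have hWpos : 0 ≤ τ ^ h * W := (Nat.cast_nonneg _).trans (hW τ h1 h2)
    calc (coveringNumber A.Λ (r₀ / τ) : ℝ)
        ≤ coveringNumber (range A.p) (r₀ / τ / 4) +
          ∑ i ∈ hfin.toFinset, (coveringNumber A.Λ (r₀ / τ / A.ρ i) : ℝ) := by
            exact_mod_cast hstep
      _ ≤ τ ^ h * W + ∑ i ∈ hfin.toFinset, A.ρ i ^ h * ((n + 1) * (τ ^ h * W)) := by
          refine add_le_add (hW τ h1 h2) (Finset.sum_le_sum fun i hi => ?_)
          have hi' : r₀ / τ / 4 < A.ρ i := by simpa using hi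
          have hρ := A.ρ_pos i
          have hρ1 := A.ρ_le i
          have e : r₀ / τ / A.ρ i = r₀ / (τ * A.ρ i) := by rw [div_div]
          rw [e]
          refine (ih (τ * A.ρ i) ?_ ?_ ?_).trans_eq ?_
          · rw [div_div, div_lt_iff₀ (by positivity)] at hi'
            linarith
          · nlinarith
          · rw [← e, le_div_iff₀ hρ]
            rw [pow_succ] at h3
            have : (0 : ℝ) ≤ 2 * (1 / 16) ^ n := by positivity
            nlinarith
          · rw [Real.mul_rpow hτ.le hρ.le]
            ring
      _ ≤ τ ^ h * W + 1 * ((n + 1) * (τ ^ h * W)) := by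
          rw [← Finset.sum_mul]
          gcongr
          exact sum_le_hasSum _ (fun i _ => Real.rpow_nonneg (A.ρ_pos i).le _) hsum
      _ = _ := by push_cast; ring

theorem exists_finset_one_le_sum {h h' : ℝ} (hsum : HasSum (fun i => A.ρ i ^ h) 1)
    (hlt : h' < h) : ∃ J : Finset A.I, 1 ≤ ∑ i ∈ J, A.ρ i ^ h' := by
  have h1 : (1 / 16 : ℝ) ^ (h - h') < 1 :=
    Real.rpow_lt_one (by norm_num) (by norm_num) (by linarith)
  obtain ⟨J, hJ⟩ := (hsum.eventually (lt_mem_nhds h1)).exists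
  refine ⟨J, ?_⟩
  have h2 : ∑ i ∈ J, A.ρ i ^ h ≤ ∑ i ∈ J, A.ρ i ^ h' * (1 / 16 : ℝ) ^ (h - h') := by
    refine Finset.sum_le_sum fun i _ => ?_
    have : A.ρ i ^ h = A.ρ i ^ h' * A.ρ i ^ (h - h') := by
      rw [← Real.rpow_add (A.ρ_pos i)]; congr 1; ring
    rw [this]
    exact mul_le_mul_of_nonneg_left
      (Real.rpow_le_rpow (A.ρ_pos i).le (A.ρ_le i) (by linarith))
      (Real.rpow_nonneg (A.ρ_pos i).le _)
  rw [← Finset.sum_mul] at h2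
  have h3 : (0 : ℝ) < (1 / 16) ^ (h - h') := by positivity
  by_contra! hcon
  nlinarith

theorem exists_ρ_lower_bound (J : Finset A.I) :
    ∃ η : ℝ, 0 < η ∧ η ≤ 1 ∧ ∀ i ∈ J, η ≤ A.ρ i := by
  classical
  induction J using Finset.induction_on with
  | empty => exact ⟨1, one_pos, le_rfl, by simp⟩
  | insert a J _ ih =>
    obtain ⟨η, h1, h2, h3⟩ := ih
    refine ⟨min η (A.ρ a), lt_min h1 (A.ρ_pos a), (min_le_left _ _).trans h2, fun i hi => ?_⟩
    rcases Finset.mem_insert.1 hi with rfl | hi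
    · exact min_le_right _ _
    · exact (min_le_left _ _).trans (h3 i hi)

/-- Lower bound for the covering numbers of the limit set through those of the fixed points. -/
theorem exists_le_coveringNumber_Λ {h h' : ℝ} (hsum : HasSum (fun i => A.ρ i ^ h) 1)
    (h0 : 0 < h') (hlt : h' < h) : ∃ c : ℝ, 0 < c ∧ ∀ q, 0 < q → q ≤ 1 → ∀ τ, 0 < τ → τ ≤ 1 →
      c * (τ ^ (-h') * coveringNumber (range A.p) q) ≤ coveringNumber A.Λ (q * τ) := by
  obtain ⟨J, hJ⟩ := A.exists_finset_one_le_sum hsum hlt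
  obtain ⟨η, hη0, hη1, hη⟩ := A.exists_ρ_lower_bound J
  refine ⟨η ^ h', by positivity, fun q hq hq1 => ?_⟩
  have hbig : ∀ τ, η ≤ τ → τ ≤ 1 →
      η ^ h' * (τ ^ (-h') * coveringNumber (range A.p) q) ≤ coveringNumber A.Λ (q * τ) := by
    intro τ h1 h2
    have hτ : 0 < τ := hη0.trans_le h1
    have h3 : (coveringNumber (range A.p) q : ℝ) ≤ coveringNumber A.Λ (q * τ) := by
      have := coveringNumber_mono A.isBounded_Λ hq A.range_p_subset_Λ
      have h' := coveringNumber_anti A.isBounded_Λ (by positivity : 0 < q * τ)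
        (by nlinarith : q * τ ≤ q)
      exact_mod_cast this.trans h'
    refine le_trans ?_ h3
    rw [← mul_assoc, Real.rpow_neg hτ.le, ← div_eq_mul_inv]
    refine mul_le_of_le_one_left (Nat.cast_nonneg _) ?_
    rw [div_le_one (by positivity)]
    exact Real.rpow_le_rpow hη0.le h1 h0.le
  have key : ∀ n : ℕ, ∀ τ, (1 / 16 : ℝ) ^ n ≤ τ → τ ≤ 1 →
      η ^ h' * (τ ^ (-h') * coveringNumber (range A.p) q) ≤ coveringNumber A.Λ (q * τ) := by
    intro n
    induction n with
    | zero =>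
      intro τ h1 h2
      exact hbig τ (by rw [pow_zero] at h1; linarith) h2
    | succ n ih =>
      intro τ h1 h2
      have hτ : 0 < τ := lt_of_lt_of_le (by positivity) h1
      rcases le_or_gt η τ with h3 | h3
      · exact hbig τ h3 h2
      have hsep := sum_coveringNumber_le J (fun i => A.map i '' A.Λ) A.isBounded_Λ
        (by positivity : 0 < q * τ) (fun i _ => A.map_image_Λ_subset i) (by
          rintro i hi j hj hij _ ⟨x, hx, rfl⟩ _ ⟨y, hy, rfl⟩
          have := A.le_dist_map hij (A.Λ_subset hx) (A.Λ_subset hy)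
          have := hη i hi
          nlinarith)
      have hterm : ∀ i ∈ J, A.ρ i ^ h' * (η ^ h' * (τ ^ (-h') * coveringNumber (range A.p) q)) ≤
          coveringNumber (A.map i '' A.Λ) (q * τ) := by
        intro i hi
        have hρ := A.ρ_pos i
        have hρη := hη i hi
        have h4 := ih (τ / A.ρ i) (by
          rw [le_div_iff₀ hρ]
          rw [pow_succ] at h1
          have := A.ρ_le i
          have : (0 : ℝ) < (1 / 16) ^ n := by positivity
          nlinarith) ((div_le_one hρ).2 (by linarith))
        have h5 := coveringNumber_image_le
          (A.isBounded_Λ.subset (A.map_image_Λ_subset i)) (by positivity : 0 < q * τ)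
          (inv_pos.2 hρ) (A.dist_invMap i)
        rw [image_image] at h5
        simp only [A.invMap_map, image_id'] at h5
        rw [show (A.ρ i)⁻¹ * (q * τ) = q * (τ / A.ρ i) by ring] at h5
        refine le_trans (le_of_eq ?_) (h4.trans (by exact_mod_cast h5))
        rw [Real.div_rpow hτ.le hρ.le, Real.rpow_neg hρ.le, div_inv_eq_mul]
        ring
      calc η ^ h' * (τ ^ (-h') * coveringNumber (range A.p) q)
          ≤ (∑ i ∈ J, A.ρ i ^ h') * (η ^ h' * (τ ^ (-h') * coveringNumber (range A.p) q)) :=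
            le_mul_of_one_le_left (by positivity) hJ
        _ = ∑ i ∈ J, A.ρ i ^ h' * (η ^ h' * (τ ^ (-h') * coveringNumber (range A.p) q)) :=
            Finset.sum_mul _ _ _
        _ ≤ ∑ i ∈ J, (coveringNumber (A.map i '' A.Λ) (q * τ) : ℝ) := Finset.sum_le_sum hterm
        _ ≤ _ := by exact_mod_cast hsep
  intro τ hτ hτ1
  obtain ⟨n, hn⟩ := exists_pow_lt_of_lt_one hτ (by norm_num : (1 / 16 : ℝ) < 1)
  exact key n τ hn.le hτ1

/-! ### Hausdorff dimension of the limit set -/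

theorem ediam_map_image_le (i : A.I) (E : Set (EuclideanSpace ℝ (Fin d))) :
    ediam (A.map i '' E) ≤ ENNReal.ofReal (A.ρ i) * ediam E := by
  refine ediam_le ?_
  rintro _ ⟨x, hx, rfl⟩ _ ⟨y, hy, rfl⟩
  rw [edist_dist, A.dist_map, ENNReal.ofReal_mul (A.ρ_pos i).le, ← edist_dist]
  gcongr
  exact edist_le_ediam_of_mem hx hy

theorem exists_cylinder_cover {h : ℝ} (hh : 0 < h) (hsum : HasSum (fun i => A.ρ i ^ h) 1)
    (k : ℕ) : ∃ (β : Type) (_ : Countable β) (t : β → Set (EuclideanSpace ℝ (Fin d))),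
      A.Λ ⊆ ⋃ b, t b ∧ (∀ b, ediam (t b) ≤ ENNReal.ofReal (2 * (1 / 16) ^ k)) ∧
      ∑' b, ediam (t b) ^ h ≤ ENNReal.ofReal 2 ^ h := by
  induction k with
  | zero =>
    have h2 : ediam (closedBall (0 : EuclideanSpace ℝ (Fin d)) 1) ≤ ENNReal.ofReal 2 := by
      refine ediam_le fun x hx y hy => ?_
      rw [edist_dist]
      refine ENNReal.ofReal_le_ofReal ?_
      rw [mem_closedBall] at hx hy
      linarith [dist_triangle_right x y 0]
    refine ⟨Unit, inferInstance, fun _ => closedBall 0 1, ?_, fun _ => by simpa using h2, ?_⟩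
    · simpa [iUnion_const] using A.Λ_subset
    · simpa using ENNReal.rpow_le_rpow h2 hh.le
  | succ k ih =>
    obtain ⟨β, hβ, t, h1, h2, h3⟩ := ih
    have := A.countable
    refine ⟨A.I × β, inferInstance, fun b => A.map b.1 '' t b.2, ?_, fun b => ?_, ?_⟩
    · intro x hx
      obtain ⟨i, y, hy, rfl⟩ := mem_iUnion.1 (A.Λ_subset_iUnion hx)
      obtain ⟨b, hb⟩ := mem_iUnion.1 (h1 hy)
      exact mem_iUnion.2 ⟨(i, b), mem_image_of_mem _ hb⟩
    · refine (A.ediam_map_image_le b.1 _).trans ?_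
      calc ENNReal.ofReal (A.ρ b.1) * ediam (t b.2)
          ≤ ENNReal.ofReal (1 / 16) * ENNReal.ofReal (2 * (1 / 16) ^ k) := by
            gcongr
            · exact A.ρ_le _
            · exact h2 _
        _ = _ := by
            rw [← ENNReal.ofReal_mul (by norm_num)]
            congr 1
            ring
    · have hs : ∑' i, ENNReal.ofReal (A.ρ i) ^ h = 1 := by
        have e : ∀ i, ENNReal.ofReal (A.ρ i) ^ h = ENNReal.ofReal (A.ρ i ^ h) := fun i =>
          ENNReal.ofReal_rpow_of_nonneg (A.ρ_pos i).le hh.le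
        simp_rw [e]
        rw [← ENNReal.ofReal_tsum_of_nonneg (fun i => Real.rpow_nonneg (A.ρ_pos i).le _)
          hsum.summable, hsum.tsum_eq, ENNReal.ofReal_one]
      calc ∑' b : A.I × β, ediam (A.map b.1 '' t b.2) ^ h
          ≤ ∑' b : A.I × β, ENNReal.ofReal (A.ρ b.1) ^ h * ediam (t b.2) ^ h := by
            refine ENNReal.tsum_le_tsum fun b => ?_
            rw [← ENNReal.mul_rpow_of_nonneg _ _ hh.le]
            exact ENNReal.rpow_le_rpow (A.ediam_map_image_le _ _) hh.le
        _ = (∑' i, ENNReal.ofReal (A.ρ i) ^ h) * ∑' b, ediam (t b) ^ h := by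
            rw [ENNReal.tsum_prod (f := fun i b => ENNReal.ofReal (A.ρ i) ^ h * ediam (t b) ^ h)]
            simp_rw [ENNReal.tsum_mul_left, ENNReal.tsum_mul_right]
        _ ≤ _ := by rwa [hs, one_mul]

theorem dimH_Λ_le {h : ℝ} (hh : 0 < h) (hsum : HasSum (fun i => A.ρ i ^ h) 1) :
    dimH A.Λ ≤ ENNReal.ofReal h := by
  choose β hβ t h1 h2 h3 using A.exists_cylinder_cover hh hsum
  have hr : Tendsto (fun k : ℕ => ENNReal.ofReal (2 * (1 / 16) ^ k)) atTop (𝓝 0) := by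
    rw [← ENNReal.ofReal_zero]
    refine ENNReal.tendsto_ofReal ?_
    simpa using (tendsto_pow_atTop_nhds_zero_of_lt_one (by norm_num : (0 : ℝ) ≤ 1 / 16)
      (by norm_num)).const_mul 2
  have hle := Measure.hausdorffMeasure_le_liminf_tsum h A.Λ _ hr t
    (Eventually.of_forall h2) (Eventually.of_forall h1)
  refine dimH_le_of_hausdorffMeasure_ne_top (d := h.toNNReal) (ne_top_of_le_ne_top ?_
    ((Real.coe_toNNReal h hh.le).symm ▸ hle))
  refine ne_top_of_le_ne_top (b := ENNReal.ofReal 2 ^ h)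
    (ENNReal.rpow_ne_top_of_nonneg hh.le ENNReal.ofReal_ne_top) ?_
  rw [Real.coe_toNNReal h hh.le]
  exact (liminf_le_liminf (Eventually.of_forall h3)).trans_eq (liminf_const (f := atTop) _)

theorem nonempty_iInter_cylinder (γ : ℕ → A.I) :
    (⋂ n : ℕ, compMaps A.map (List.ofFn fun k : Fin (n + 1) => γ k) '' closedBall 0 1).Nonempty := by
  have hcont : ∀ w : List A.I, Continuous (compMaps A.map w) := fun w => by
    induction w with
    | nil => exact continuous_id
    | cons i w ih => exact (A.contDiff_map i).continuous.comp ih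
  have hcpt : ∀ w : List A.I, IsCompact (compMaps A.map w '' closedBall 0 1) := fun w =>
    (isCompact_closedBall 0 1).image (hcont w)
  refine IsCompact.nonempty_iInter_of_sequence_nonempty_isCompact_isClosed _ (fun n => ?_)
    (fun n => ⟨_, mem_image_of_mem _ (mem_closedBall_self zero_le_one)⟩) (hcpt _)
    fun n => (hcpt _).isClosed
  suffices H : ∀ n : ℕ, ∀ γ : ℕ → A.I,
      compMaps A.map (List.ofFn fun k : Fin (n + 1) => γ k) '' closedBall 0 1 ⊆
        compMaps A.map (List.ofFn fun k : Fin n => γ k) '' closedBall 0 1 from H (n + 1) γ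
  intro n
  induction n with
  | zero =>
    intro γ
    rintro _ ⟨x, hx, rfl⟩
    exact ⟨compMaps A.map (List.ofFn fun k : Fin (0 + 1) => γ k) x, A.compMaps_mapsTo _ hx, by
      simp [compMaps]⟩
  | succ n ih =>
    intro γ
    rw [A.compMaps_ofFn_succ, A.compMaps_ofFn_succ, image_comp, image_comp]
    exact image_mono (ih fun k => γ (k + 1))

end SeparatedSystem

/-- An interval of length `∑ p` is covered by translates of intervals of lengths `p i`. -/
theorem exists_interval_coding {ι : Type*} (J : Finset ι) (p : ι → ℝ) (hp : ∀ i, 0 < p i) :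
    ∃ a : ι → ℝ, ∀ y ∈ Icc 0 (∑ i ∈ J, p i), J.Nonempty →
      ∃ i ∈ J, ∃ u ∈ Icc (0 : ℝ) 1, y = a i + p i * u := by
  classical
  induction J using Finset.induction_on with
  | empty => exact ⟨0, by simp⟩
  | insert b J hb ih =>
    obtain ⟨a, ha⟩ := ih
    refine ⟨Function.update a b (∑ i ∈ J, p i), fun y hy _ => ?_⟩
    rw [Finset.sum_insert hb] at hy
    rcases le_or_gt (∑ i ∈ J, p i) y with hle | hlt
    · refine ⟨b, Finset.mem_insert_self _ _, (y - ∑ i ∈ J, p i) / p b,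
        ⟨div_nonneg (by linarith) (hp b).le, (div_le_one (hp b)).2 (by linarith [hy.2])⟩, ?_⟩
      rw [Function.update_self, mul_div_cancel₀ _ (hp b).ne']
      ring
    · have hne : J.Nonempty := by
        rw [Finset.nonempty_iff_ne_empty]
        rintro rfl
        rw [Finset.sum_empty] at hlt
        linarith [hy.1]
      obtain ⟨i, hi, u, hu, e⟩ := ha y ⟨hy.1, hlt.le⟩ hne
      refine ⟨i, Finset.mem_insert_of_mem hi, u, hu, ?_⟩
      rwa [Function.update_of_ne (by rintro rfl; exact hb hi)]

namespace SeparatedSystem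

variable {d : ℕ} (A : SeparatedSystem d)

theorem le_dimH_Λ_of_lt {h h' : ℝ} (hsum : HasSum (fun i => A.ρ i ^ h) 1)
    (h0 : 0 < h') (hlt : h' < h) : ENNReal.ofReal h' ≤ dimH A.Λ := by
  obtain ⟨J, hJ⟩ := A.exists_finset_one_le_sum hsum hlt
  obtain ⟨η, hη0, hη1, hη⟩ := A.exists_ρ_lower_bound J
  have hJne : J.Nonempty := by
    rw [Finset.nonempty_iff_ne_empty]
    rintro rfl
    simp at hJ
    linarith
  have hp : ∀ i, 0 < A.ρ i ^ h' := fun i => Real.rpow_pos_of_pos (A.ρ_pos i) _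
  obtain ⟨a, ha⟩ := exists_interval_coding J (fun i => A.ρ i ^ h') hp
  have hcode : ∀ y : Icc (0 : ℝ) 1, ∃ (i : A.I) (u : Icc (0 : ℝ) 1),
      i ∈ J ∧ (y : ℝ) = a i + A.ρ i ^ h' * u := fun y => by
    obtain ⟨i, hi, u, hu, e⟩ := ha y ⟨y.2.1, y.2.2.trans hJ⟩ hJne
    exact ⟨i, ⟨u, hu⟩, hi, e⟩
  choose digit shift hdig hshift using hcode
  let code : Icc (0 : ℝ) 1 → ℕ → A.I := fun y n => digit (shift^[n] y)
  have hcode0 : ∀ y, code y 0 = digit y := fun y => rfl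
  have hcodeS : ∀ y, (fun n => code y (n + 1)) = code (shift y) := fun y => rfl
  have habs : ∀ y y' : Icc (0 : ℝ) 1, digit y = digit y' →
      |(y : ℝ) - y'| = A.ρ (digit y) ^ h' * |(shift y : ℝ) - shift y'| := fun y y' e => by
    rw [hshift y, hshift y', ← e, add_sub_add_left_eq_sub, ← mul_sub, abs_mul,
      abs_of_pos (hp _)]
  have hdist1 : ∀ y y' : Icc (0 : ℝ) 1, |(y : ℝ) - y'| ≤ 1 := fun y y' =>
    abs_le.2 ⟨by linarith [y.2.1, y'.2.2], by linarith [y.2.2, y'.2.1]⟩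
  have hinj : ∀ y y', code y = code y' → y = y' := by
    have hpow : ∀ n : ℕ, ∀ y y', code y = code y' →
        |(y : ℝ) - y'| ≤ ((1 / 16 : ℝ) ^ h') ^ n := by
      intro n
      induction n with
      | zero => intro y y' _; simpa using hdist1 y y'
      | succ n ih =>
        intro y y' e
        rw [habs y y' (congrFun e 0), pow_succ']
        refine mul_le_mul (Real.rpow_le_rpow (A.ρ_pos _).le (A.ρ_le _) h0.le) (ih _ _ ?_)
          (abs_nonneg _) (by positivity)
        rw [← hcodeS, ← hcodeS, e]
    intro y y' e
    have hlim := tendsto_pow_atTop_nhds_zero_of_lt_one (by positivity)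
      (Real.rpow_lt_one (by norm_num) (by norm_num) h0 : (1 / 16 : ℝ) ^ h' < 1)
    have h1 : |(y : ℝ) - y'| ≤ 0 := ge_of_tendsto' hlim fun n => hpow n y y' e
    exact Subtype.ext (sub_eq_zero.1 (abs_nonpos_iff.1 h1))
  choose g hg using fun y => A.nonempty_iInter_cylinder (code y)
  have hgΛ : ∀ y, g y ∈ A.Λ := fun y => A.mem_Λ.2 ⟨code y, mem_iInter.1 (hg y)⟩
  have hsep : ∀ n : ℕ, ∀ y y', code y n ≠ code y' n →
      ∀ x ∈ compMaps A.map (List.ofFn fun k : Fin (n + 1) => code y k) '' closedBall 0 1,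
      ∀ x' ∈ compMaps A.map (List.ofFn fun k : Fin (n + 1) => code y' k) '' closedBall 0 1,
        |(y : ℝ) - y'| ≤ η ^ (-h') * dist x x' ^ h' := by
    intro n
    induction n with
    | zero =>
      rintro y y' hne _ ⟨x, hx, rfl⟩ _ ⟨x', hx', rfl⟩
      rw [A.compMaps_ofFn_succ, A.compMaps_ofFn_succ]
      have h1 := A.le_dist_map hne hx hx'
      have h2 := hη _ (hdig y)
      rw [← hcode0 y] at h2
      have h3 : η ^ h' ≤ dist (A.map (code y 0) x) (A.map (code y' 0) x') ^ h' :=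
        Real.rpow_le_rpow hη0.le (by linarith) h0.le
      refine (hdist1 y y').trans ?_
      calc (1 : ℝ) = η ^ (-h') * η ^ h' := by rw [← Real.rpow_add hη0]; simp
        _ ≤ _ := mul_le_mul_of_nonneg_left h3 (by positivity)
    | succ n ih =>
      rintro y y' hne _ ⟨x, hx, rfl⟩ _ ⟨x', hx', rfl⟩
      rw [A.compMaps_ofFn_succ, A.compMaps_ofFn_succ, Function.comp_apply, Function.comp_apply]
      by_cases h1 : digit y = digit y'
      · have h2 := ih (shift y) (shift y') hne _ (mem_image_of_mem _ hx) _
          (mem_image_of_mem _ hx')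
        rw [habs y y' h1, hcode0, hcode0, ← h1, A.dist_map,
          Real.mul_rpow (A.ρ_pos _).le dist_nonneg, mul_left_comm]
        exact mul_le_mul_of_nonneg_left h2 (hp _).le
      · have h1' := A.le_dist_map h1 (A.compMaps_mapsTo
          (List.ofFn fun k : Fin (n + 1) => code y (k + 1)) hx) (A.compMaps_mapsTo
          (List.ofFn fun k : Fin (n + 1) => code y' (k + 1)) hx')
        have h2 := hη _ (hdig y)
        have h3 := Real.rpow_le_rpow hη0.le (show η ≤ _ by linarith) h0.le
        refine (hdist1 y y').trans ?_
        calc (1 : ℝ) = η ^ (-h') * η ^ h' := by rw [← Real.rpow_add hη0]; simp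
          _ ≤ _ := mul_le_mul_of_nonneg_left h3 (by positivity)
  have hgdist : ∀ y y' : Icc (0 : ℝ) 1, |(y : ℝ) - y'| ≤ η ^ (-h') * dist (g y) (g y') ^ h' := by
    intro y y'
    by_cases e : code y = code y'
    · rw [hinj y y' e, sub_self, abs_zero]
      positivity
    · obtain ⟨n, hn⟩ := Function.ne_iff.1 e
      exact hsep n y y' hn _ (mem_iInter.1 (hg y) n) _ (mem_iInter.1 (hg y') n)
  have hginj : Function.Injective g := fun y y' e => by
    have h1 := hgdist y y'
    rw [e, dist_self, Real.zero_rpow h0.ne', mul_zero] at h1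
    exact Subtype.ext (sub_eq_zero.1 (abs_nonpos_iff.1 h1))
  let f : EuclideanSpace ℝ (Fin d) → ℝ := fun x =>
    ((Function.invFun g x : Icc (0 : ℝ) 1) : ℝ)
  have hfg : ∀ y, f (g y) = y := fun y => by
    simp only [f, Function.leftInverse_invFun hginj y]
  have hhol : HolderOnWith (η ^ (-h')).toNNReal h'.toNNReal f (range g) := by
    rintro _ ⟨y, rfl⟩ _ ⟨y', rfl⟩
    rw [hfg, hfg, edist_dist, edist_dist, Real.dist_eq, Real.coe_toNNReal _ h0.le,
      ENNReal.ofReal_rpow_of_nonneg dist_nonneg h0.le]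
    change _ ≤ ENNReal.ofReal (η ^ (-h')) * _
    rw [← ENNReal.ofReal_mul (by positivity)]
    exact ENNReal.ofReal_le_ofReal (hgdist y y')
  have him : f '' range g = Icc 0 1 := by
    ext y
    constructor
    · rintro ⟨_, ⟨y, rfl⟩, rfl⟩
      rw [hfg]
      exact y.2
    · exact fun hy => ⟨g ⟨y, hy⟩, mem_range_self _, hfg _⟩
  have hdim := hhol.dimH_image_le (Real.toNNReal_pos.2 h0)
  rw [him, Real.dimH_of_mem_nhds (Icc_mem_nhds (by norm_num : (0 : ℝ) < 1 / 2) (by norm_num)),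
    Module.finrank_self, Nat.cast_one] at hdim
  have hne0 : (h'.toNNReal : ENNReal) ≠ 0 := by
    simpa using h0
  rw [ENNReal.le_div_iff_mul_le (Or.inl hne0) (Or.inl ENNReal.coe_ne_top), one_mul] at hdim
  exact hdim.trans (dimH_mono (range_subset_iff.2 hgΛ))

theorem dimH_Λ {h : ℝ} (hh : 0 < h) (hsum : HasSum (fun i => A.ρ i ^ h) 1) :
    dimH A.Λ = ENNReal.ofReal h := by
  refine le_antisymm (A.dimH_Λ_le hh hsum) (le_of_forall_lt fun x hx => ?_)
  obtain ⟨y, hxy, hyh⟩ := exists_between hx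
  have hy : y ≠ ⊤ := ne_top_of_lt hyh
  have h0 : 0 < y.toReal := ENNReal.toReal_pos (ne_bot_of_gt hxy) hy
  refine hxy.trans_le ((ENNReal.ofReal_toReal hy).symm.trans_le
    (A.le_dimH_Λ_of_lt hsum h0 ?_))
  exact (ENNReal.lt_ofReal_iff_toReal_lt hy).1 hyh

end SeparatedSystem

/-! ### Grids accumulating at the origin -/

section Grid

variable {d : ℕ}

theorem norm_le_sum_abs (x : EuclideanSpace ℝ (Fin d)) : ‖x‖ ≤ ∑ j, |x j| := by
  rw [EuclideanSpace.norm_eq, Real.sqrt_le_left (Finset.sum_nonneg fun _ _ => abs_nonneg _)]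
  simpa using Finset.sum_sq_le_sq_sum_of_nonneg (s := Finset.univ) (f := fun j => |x j|)
    fun _ _ => abs_nonneg _

theorem abs_sub_le_dist (x y : EuclideanSpace ℝ (Fin d)) (j : Fin d) : |x j - y j| ≤ dist x y := by
  rw [dist_eq_norm]
  exact PiLp.norm_apply_le (x - y) j

theorem coveringNumber_le_of_subset_cube (hd : 0 < d) {E : Set (EuclideanSpace ℝ (Fin d))}
    {z l q : ℝ} (hq : 0 < q) (hE : ∀ x ∈ E, ∀ j, z ≤ x j ∧ x j ≤ z + l) :
    coveringNumber E q ≤ (⌊d * l / q⌋₊ + 1) ^ d := by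
  classical
  have hd' : (0 : ℝ) < d := Nat.cast_pos.2 hd
  let c : (Fin d → Fin (⌊d * l / q⌋₊ + 1)) → EuclideanSpace ℝ (Fin d) := fun k =>
    WithLp.toLp 2 fun j => z + (k j + 1 / 2) * (q / d)
  refine (coveringNumber_le_card (Finset.univ.image c) fun x hx => ?_).trans
    (Finset.card_image_le.trans_eq (by simp))
  have hk : ∀ j, ⌊d * (x j - z) / q⌋₊ < ⌊d * l / q⌋₊ + 1 := fun j => by
    refine Nat.lt_succ_of_le (Nat.floor_le_floor ?_)
    gcongr
    linarith [(hE x hx j).2]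
  refine mem_iUnion₂.2 ⟨c fun j => ⟨_, hk j⟩, Finset.mem_image_of_mem _ (Finset.mem_univ _), ?_⟩
  rw [mem_ball, dist_eq_norm]
  refine (norm_le_sum_abs _).trans_lt ?_
  calc ∑ j, |(x - c fun j => ⟨_, hk j⟩) j| ≤ ∑ _j : Fin d, q / d / 2 := by
        refine Finset.sum_le_sum fun j _ => ?_
        have h0 : 0 ≤ d * (x j - z) / q :=
          div_nonneg (mul_nonneg hd'.le (by linarith [(hE x hx j).1])) hq.le
        have h1 := Nat.floor_le h0
        have h2 := Nat.lt_floor_add_one (d * (x j - z) / q)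
        have e : x j - z = d * (x j - z) / q * (q / d) := by field_simp
        have h3 := mul_le_mul_of_nonneg_right h1 (div_pos hq hd').le
        have h4 := mul_le_mul_of_nonneg_right h2.le (div_pos hq hd').le
        have e2 : (x - c fun j => ⟨_, hk j⟩) j =
          x j - (z + ((⌊d * (x j - z) / q⌋₊ : ℝ) + 1 / 2) * (q / d)) := rfl
        rw [e2, abs_le]
        constructor <;> linarith
    _ = q / 2 := by
        simp
        field_simp
    _ < q := by linarith

/-- A point of the grid with spacing `δ` and corner `(exp (-n) / (2 * d), …, exp (-n) / (2 * d))`. -/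
def gridPoint (d n : ℕ) (δ : ℝ) (k : Fin d → ℕ) : EuclideanSpace ℝ (Fin d) :=
  WithLp.toLp 2 fun j => Real.exp (-n) / (2 * d) + δ * k j

theorem gridPoint_apply (n : ℕ) (δ : ℝ) (k : Fin d → ℕ) (j : Fin d) :
    gridPoint d n δ k j = Real.exp (-n) / (2 * d) + δ * k j := rfl

theorem mul_le_dist_gridPoint {n : ℕ} {δ : ℝ} (hδ : 0 ≤ δ) {k k' : Fin d → ℕ} {g : ℕ}
    {j : Fin d} (hj : k j + g ≤ k' j) :
    δ * g ≤ dist (gridPoint d n δ k) (gridPoint d n δ k') := by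
  refine le_trans ?_ (abs_sub_le_dist _ _ j)
  rw [gridPoint_apply, gridPoint_apply, add_sub_add_left_eq_sub, abs_sub_comm, ← mul_sub,
    abs_mul, abs_of_nonneg hδ]
  refine mul_le_mul_of_nonneg_left (le_trans ?_ (le_abs_self _)) hδ
  have : ((k j + g : ℕ) : ℝ) ≤ k' j := Nat.cast_le.2 hj
  push_cast at this
  linarith

theorem le_dist_gridPoint {n : ℕ} {δ : ℝ} (hδ : 0 ≤ δ) {k k' : Fin d → ℕ} (g : ℕ)
    (h : ∃ j, k j + g ≤ k' j ∨ k' j + g ≤ k j) :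
    δ * g ≤ dist (gridPoint d n δ k) (gridPoint d n δ k') := by
  obtain ⟨j, hj | hj⟩ := h
  · exact mul_le_dist_gridPoint hδ hj
  · rw [dist_comm]
    exact mul_le_dist_gridPoint hδ hj

/-- The spacings, sizes and contraction ratios of a sequence of grids. -/
structure GridData (d : ℕ) where
  pos : 0 < d
  /-- number of grid points per axis -/
  m : ℕ → ℕ
  /-- spacings -/
  δ : ℕ → ℝ
  /-- contraction ratios -/
  σ : ℕ → ℝ
  m_pos : ∀ n, 0 < m n
  δ_pos : ∀ n, 0 < δ n
  m_mul_δ_le : ∀ n, m n * δ n ≤ Real.exp (-n) / (8 * d)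
  σ_pos : ∀ n, 0 < σ n
  σ_le : ∀ n, 16 * σ n ≤ δ n

namespace GridData

variable (G : GridData d)

/-- The point with index `i`. -/
def point (i : Σ n : ℕ, Fin d → Fin (G.m n)) : EuclideanSpace ℝ (Fin d) :=
  gridPoint d i.1 (G.δ i.1) fun j => i.2 j

theorem point_apply_bounds (i : Σ n : ℕ, Fin d → Fin (G.m n)) (j : Fin d) :
    Real.exp (-i.1) / (2 * d) ≤ G.point i j ∧
      G.point i j ≤ Real.exp (-i.1) / (2 * d) + G.m i.1 * G.δ i.1 := by
  rw [point, gridPoint_apply, mul_comm (G.m i.1 : ℝ)]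
  have h1 : ((i.2 j : ℕ) : ℝ) ≤ G.m i.1 := Nat.cast_le.2 (i.2 j).2.le
  have h2 := mul_le_mul_of_nonneg_left h1 (G.δ_pos i.1).le
  have h3 := mul_nonneg (G.δ_pos i.1).le (Nat.cast_nonneg (α := ℝ) (i.2 j : ℕ))
  exact ⟨by linarith, by linarith⟩

theorem norm_point_lt (i : Σ n : ℕ, Fin d → Fin (G.m n)) : ‖G.point i‖ < Real.exp (-i.1) := by
  have hd : (0 : ℝ) < d := Nat.cast_pos.2 G.pos
  have he := Real.exp_pos (-i.1)
  refine (norm_le_sum_abs _).trans_lt ?_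
  calc ∑ j, |G.point i j| ≤ ∑ _j : Fin d, 5 / 8 * (Real.exp (-i.1) / d) := by
        refine Finset.sum_le_sum fun j _ => ?_
        obtain ⟨h1, h2⟩ := G.point_apply_bounds i j
        rw [abs_of_nonneg (le_trans (by positivity) h1)]
        refine h2.trans ((add_le_add_right (G.m_mul_δ_le i.1) _).trans_eq ?_)
        field_simp
        norm_num
    _ = 5 / 8 * Real.exp (-i.1) := by
        simp
        field_simp
    _ < _ := by linarith

theorem δ_le (n : ℕ) : G.δ n ≤ Real.exp (-n) / (8 * d) := by
  have h1 : (1 : ℝ) ≤ G.m n := Nat.one_le_cast.2 (G.m_pos n)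
  have := mul_le_mul_of_nonneg_right h1 (G.δ_pos n).le
  linarith [G.m_mul_δ_le n]

theorem le_dist_point_of_lt {i j : Σ n : ℕ, Fin d → Fin (G.m n)} (hij : i.1 < j.1) :
    Real.exp (-i.1) / (8 * d) ≤ dist (G.point i) (G.point j) := by
  have hd : (0 : ℝ) < d := Nat.cast_pos.2 G.pos
  refine le_trans ?_ ((le_abs_self _).trans (abs_sub_le_dist _ _ ⟨0, G.pos⟩))
  have h1 := (G.point_apply_bounds i ⟨0, G.pos⟩).1
  have h2 := (G.point_apply_bounds j ⟨0, G.pos⟩).2.trans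
    (add_le_add_right (G.m_mul_δ_le j.1) _)
  have h3 : Real.exp (-j.1) ≤ Real.exp (-i.1) / 2 := by
    have h4 : (i.1 : ℝ) + 1 ≤ j.1 := by exact_mod_cast hij
    have h5 : Real.exp (-j.1) ≤ Real.exp (-i.1) * Real.exp (-1) := by
      rw [← Real.exp_add]
      exact Real.exp_le_exp.2 (by linarith)
    have h6 : Real.exp (-1) ≤ 1 / 2 := by
      rw [Real.exp_neg, one_div]
      exact inv_anti₀ two_pos (by linarith [Real.add_one_le_exp (1 : ℝ)])
    nlinarith [Real.exp_pos (-i.1 : ℝ)]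
  have h4 : Real.exp (-j.1) / (2 * d) + Real.exp (-j.1) / (8 * d) =
      5 / 8 * (Real.exp (-j.1) / d) := by field_simp; norm_num
  have h5 : Real.exp (-i.1) / (2 * d) = 1 / 2 * (Real.exp (-i.1) / d) := by field_simp
  have h6 : Real.exp (-i.1) / (8 * d) = 1 / 8 * (Real.exp (-i.1) / d) := by field_simp
  have h7 : Real.exp (-j.1) / d ≤ 1 / 2 * (Real.exp (-i.1) / d) := by
    rw [← mul_div_assoc]
    gcongr
    linarith
  have h8 : 0 < Real.exp (-i.1) / d := by positivity
  linarith

theorem le_dist_point {i j : Σ n : ℕ, Fin d → Fin (G.m n)} (hij : i ≠ j) :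
    G.δ i.1 ≤ dist (G.point i) (G.point j) := by
  rcases lt_trichotomy i.1 j.1 with h | h | h
  · exact (G.δ_le _).trans (G.le_dist_point_of_lt h)
  · obtain ⟨n, k⟩ := i
    obtain ⟨n', k'⟩ := j
    obtain rfl : n = n' := h
    have hk : k ≠ k' := fun e => hij (by rw [e])
    obtain ⟨l, hl⟩ := Function.ne_iff.1 hk
    have := le_dist_gridPoint (n := n) (G.δ_pos n).le (k := fun j => k j) (k' := fun j => k' j) 1
      ⟨l, by have := Fin.val_ne_of_ne hl; omega⟩
    simpa [point] using this
  · rw [dist_comm]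
    refine le_trans ((G.δ_le _).trans ?_) (G.le_dist_point_of_lt h)
    gcongr

/-- The homotheties centred at the grid points. -/
def toSystem : SeparatedSystem d where
  I := Σ n : ℕ, Fin d → Fin (G.m n)
  countable := inferInstance
  nonempty := ⟨⟨0, fun _ => ⟨0, G.m_pos 0⟩⟩⟩
  p := G.point
  ρ i := G.σ i.1
  norm_p_le i := (G.norm_point_lt i).le.trans (Real.exp_le_one_iff.2 (by simp))
  ρ_pos i := G.σ_pos _
  ρ_le i := by
    have h1 := (G.σ_le i.1).trans (G.δ_le i.1)
    have h2 : Real.exp (-i.1) / (8 * d) ≤ 1 := by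
      have hd : (1 : ℝ) ≤ d := Nat.one_le_cast.2 G.pos
      rw [div_le_one (by linarith)]
      have : Real.exp (-i.1) ≤ 1 := Real.exp_le_one_iff.2 (by simp)
      linarith
    linarith
  sep i j hij := (G.σ_le _).trans (G.le_dist_point hij)

theorem isBounded_range_point : Bornology.IsBounded (range G.point) :=
  G.toSystem.isBounded_Λ.subset G.toSystem.range_p_subset_Λ

theorem le_coveringNumber_range_point (n : ℕ) {q : ℝ} (hq : 0 < q) :
    (G.m n / (2 * q / G.δ n + 1)) ^ d ≤ (coveringNumber (range G.point) q : ℝ) := by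
  have hδ := G.δ_pos n
  set g := ⌈2 * q / G.δ n⌉₊ with hg
  have hg0 : (0 : ℝ) < g := Nat.cast_pos.2 (Nat.ceil_pos.2 (by positivity))
  have hg1 : (g : ℝ) ≤ 2 * q / G.δ n + 1 := (Nat.ceil_lt_add_one (by positivity)).le
  set K := ⌈(G.m n : ℝ) / g⌉₊ with hK
  have hlt : ∀ k : Fin K, g * (k : ℕ) < G.m n := fun k => by
    have := (lt_div_iff₀ hg0).1 (Nat.lt_ceil.1 k.2)
    rw [mul_comm]
    exact_mod_cast this
  have h := card_le_coveringNumber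
    (fun k : Fin d → Fin K => G.point ⟨n, fun j => ⟨g * (k j : ℕ), hlt (k j)⟩⟩)
    G.isBounded_range_point hq (fun k => mem_range_self _) fun k k' hkk' => by
      obtain ⟨l, hl⟩ := Function.ne_iff.1 hkk'
      refine le_trans ?_ (le_dist_gridPoint hδ.le g ⟨l, ?_⟩)
      · rw [mul_comm (G.δ n), ← div_le_iff₀ hδ]
        exact Nat.le_ceil _
      · change g * (k l : ℕ) + g ≤ g * (k' l : ℕ) ∨ g * (k' l : ℕ) + g ≤ g * (k l : ℕ)
        rcases lt_or_gt_of_ne (Fin.val_ne_of_ne hl) with h | h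
        · exact Or.inl (Nat.mul_le_mul_left g (Nat.succ_le_of_lt h))
        · exact Or.inr (Nat.mul_le_mul_left g (Nat.succ_le_of_lt h))
  calc (G.m n / (2 * q / G.δ n + 1)) ^ d ≤ (K : ℝ) ^ d := by
        gcongr
        refine le_trans ?_ (Nat.le_ceil _)
        gcongr
    _ = (Fintype.card (Fin d → Fin K) : ℕ) := by simp
    _ ≤ _ := by exact_mod_cast h

/-- The points of the `n`-th grid. -/
def block (n : ℕ) : Set (EuclideanSpace ℝ (Fin d)) :=
  range fun k : Fin d → Fin (G.m n) => G.point ⟨n, k⟩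

theorem coveringNumber_block_le_card (n : ℕ) {q : ℝ} (hq : 0 < q) :
    coveringNumber (G.block n) q ≤ G.m n ^ d := by
  classical
  refine (coveringNumber_le_card (Finset.univ.image fun k : Fin d → Fin (G.m n) =>
    G.point ⟨n, k⟩) ?_).trans (Finset.card_image_le.trans_eq (by simp))
  rintro _ ⟨k, rfl⟩
  exact mem_iUnion₂.2 ⟨_, Finset.mem_image_of_mem _ (Finset.mem_univ k), mem_ball_self hq⟩

theorem coveringNumber_block_le (n : ℕ) {q : ℝ} (hq : 0 < q) :
    (coveringNumber (G.block n) q : ℝ) ≤ (d * (G.m n * G.δ n) / q + 1) ^ d := by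
  have h := coveringNumber_le_of_subset_cube G.pos (E := G.block n) (z := Real.exp (-n) / (2 * d))
    (l := G.m n * G.δ n) hq (by rintro _ ⟨k, rfl⟩ j; exact G.point_apply_bounds ⟨n, k⟩ j)
  refine (Nat.cast_le.2 h).trans ?_
  push_cast
  have := (G.δ_pos n).le
  gcongr
  exact Nat.floor_le (by positivity)

theorem coveringNumber_range_point_le {q : ℝ} (hq : 0 < q) {N : ℕ} (hN : Real.exp (-N) ≤ q) :
    coveringNumber (range G.point) q ≤
      1 + ∑ n ∈ Finset.range N, coveringNumber (G.block n) q := by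
  have hb : ∀ n, Bornology.IsBounded (G.block n) := fun n =>
    G.isBounded_range_point.subset (range_subset_iff.2 fun k => mem_range_self _)
  have hsub : range G.point ⊆ ball 0 q ∪ ⋃ n ∈ Finset.range N, G.block n := by
    rintro _ ⟨i, rfl⟩
    rcases lt_or_ge i.1 N with h | h
    · exact Or.inr (mem_iUnion₂.2 ⟨i.1, Finset.mem_range.2 h, mem_range_self i.2⟩)
    · left
      rw [mem_ball_zero_iff]
      refine (G.norm_point_lt i).trans_le (le_trans ?_ hN)
      gcongr
  have hbU : Bornology.IsBounded (⋃ n ∈ Finset.range N, G.block n) :=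
    (Bornology.isBounded_biUnion_finset _).2 fun n _ => hb n
  refine (coveringNumber_mono (isBounded_ball.union hbU) hq hsub).trans
    ((coveringNumber_union_le isBounded_ball hbU hq).trans ?_)
  exact add_le_add (coveringNumber_le_one 0 subset_rfl)
    (coveringNumber_biUnion_le _ _ (fun n _ => hb n) hq)

end GridData

end Grid

namespace GridData

variable {d : ℕ}

theorem hasSum_toSystem_ρ (G : GridData d) {h : ℝ} {x : ℝ}
    (hs : HasSum (fun n => (G.m n : ℝ) ^ d * G.σ n ^ h) x) :
    HasSum (fun i => G.toSystem.ρ i ^ h) x := by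
  have hin : ∀ n, HasSum (fun k : Fin d → Fin (G.m n) => G.toSystem.ρ ⟨n, k⟩ ^ h)
      ((G.m n : ℝ) ^ d * G.σ n ^ h) := fun n => by
    convert hasSum_fintype (fun k : Fin d → Fin (G.m n) => G.toSystem.ρ ⟨n, k⟩ ^ h) using 1
    simp [toSystem]
  refine HasSum.sigma_of_hasSum hs hin ?_
  refine (summable_sigma_of_nonneg fun i => Real.rpow_nonneg (G.toSystem.ρ_pos i).le _).2
    ⟨fun n => (hin n).summable, ?_⟩
  exact hs.summable.congr fun n => ((hin n).tsum_eq).symm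

/-- Grids with `⌊exp (a n * n ^ 2)⌋` points per axis and spacing comparable to
`exp (-n ^ 2 - n)`, with contraction ratios whose `h`-th powers sum to `1`. -/
theorem exists_hasSum_one {h : ℝ} (hd : 0 < d) (hh : 0 < h) (hhd : h < d) {a : ℕ → ℝ}
    (ha0 : ∀ n, 0 ≤ a n) (ha1 : ∀ n, a n ≤ 1) :
    ∃ G : GridData d, HasSum (fun i => G.toSystem.ρ i ^ h) 1 ∧
      ∀ n ≠ 0, G.m n = ⌊Real.exp (a n * n ^ 2)⌋₊ ∧ G.δ n = Real.exp (-n ^ 2 - n) / (8 * d) := by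
  have hd' : (0 : ℝ) < d := Nat.cast_pos.2 hd
  have hlim : Tendsto (fun M : ℕ => (M : ℝ) ^ (d / h - 1)) atTop atTop :=
    (tendsto_rpow_atTop (sub_pos.2 ((one_lt_div hh).2 hhd))).comp tendsto_natCast_atTop_atTop
  obtain ⟨M, hM, hM0⟩ := ((hlim.eventually_ge_atTop (128 * d)).and (eventually_gt_atTop 0)).exists
  have hM0' : (0 : ℝ) < M := Nat.cast_pos.2 hM0
  let m : ℕ → ℕ := fun n => if n = 0 then M else ⌊Real.exp (a n * n ^ 2)⌋₊
  let δ : ℕ → ℝ := fun n => if n = 0 then 1 / (8 * d * M) else Real.exp (-n ^ 2 - n) / (8 * d)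
  have hm : ∀ n, 0 < m n := fun n => by
    by_cases hn : n = 0
    · simpa [m, hn] using hM0
    · simp only [m, hn, if_false]
      exact Nat.floor_pos.2 (Real.one_le_exp (mul_nonneg (ha0 n) (sq_nonneg _)))
  have hm' : ∀ n, (0 : ℝ) < m n := fun n => Nat.cast_pos.2 (hm n)
  have hδ : ∀ n, 0 < δ n := fun n => by
    by_cases hn : n = 0
    · simp only [δ, hn, if_true]; positivity
    · simp only [δ, hn, if_false]; positivity
  let τ : ℕ → ℝ := fun n => min (δ n / 16) (((1 / 2) ^ (n + 1) / (m n : ℝ) ^ d) ^ h⁻¹)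
  have hτ0 : ∀ n, 0 < τ n := fun n =>
    lt_min (by linarith [hδ n]) (Real.rpow_pos_of_pos (div_pos (by positivity)
      (pow_pos (hm' n) d)) _)
  have hτ1 : ∀ n, (m n : ℝ) ^ d * τ n ^ h ≤ (1 / 2) ^ (n + 1) := fun n => by
    have h1 : τ n ^ h ≤ (1 / 2) ^ (n + 1) / (m n : ℝ) ^ d := by
      refine (Real.rpow_le_rpow (hτ0 n).le (min_le_right _ _) hh.le).trans_eq ?_
      rw [← Real.rpow_mul (by positivity), inv_mul_cancel₀ hh.ne', Real.rpow_one]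
    rwa [le_div_iff₀ (pow_pos (hm' n) d), mul_comm] at h1
  have hg : HasSum (fun n : ℕ => (1 / 2 : ℝ) ^ (n + 1 + 1)) (1 / 2) := by
    have := (hasSum_geometric_of_lt_one (by norm_num : (0 : ℝ) ≤ 1 / 2) (by norm_num)).mul_left
      (1 / 4)
    have e : (fun n : ℕ => (1 / 2 : ℝ) ^ (n + 1 + 1)) = fun n => 1 / 4 * (1 / 2) ^ n := by
      funext n
      ring
    rw [e]
    norm_num at this ⊢
    exact this
  have hnn : ∀ n, 0 ≤ (m n : ℝ) ^ d * τ n ^ h := fun n =>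
    mul_nonneg (by positivity) (Real.rpow_nonneg (hτ0 n).le _)
  have hsum : Summable fun n => (m (n + 1) : ℝ) ^ d * τ (n + 1) ^ h :=
    Summable.of_nonneg_of_le (fun n => hnn _) (fun n => hτ1 _) hg.summable
  set S := ∑' n, (m (n + 1) : ℝ) ^ d * τ (n + 1) ^ h with hS
  have hS0 : 0 ≤ S := tsum_nonneg fun n => hnn _
  have hS1 : S ≤ 1 / 2 := hasSum_le (fun n => hτ1 _) hsum.hasSum hg
  let σ : ℕ → ℝ := fun n => if n = 0 then ((1 - S) / (M : ℝ) ^ d) ^ h⁻¹ else τ n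
  have hb : 0 < (1 - S) / (M : ℝ) ^ d := div_pos (by linarith) (by positivity)
  let G : GridData d :=
    { pos := hd, m := m, δ := δ, σ := σ, m_pos := hm, δ_pos := hδ
      m_mul_δ_le := fun n => by
        by_cases hn : n = 0
        · simp only [m, δ, hn, if_true]
          simp
          field_simp
          simp
        · simp only [m, δ, hn, if_false]
          rw [← mul_div_assoc]
          gcongr
          calc (⌊Real.exp (a n * n ^ 2)⌋₊ : ℝ) * Real.exp (-n ^ 2 - n)
              ≤ Real.exp (a n * n ^ 2) * Real.exp (-n ^ 2 - n) := by
                gcongr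
                exact Nat.floor_le (Real.exp_pos _).le
            _ ≤ Real.exp (-n) := by
                rw [← Real.exp_add]
                refine Real.exp_le_exp.2 ?_
                nlinarith [ha1 n, sq_nonneg (n : ℝ)]
      σ_pos := fun n => by
        by_cases hn : n = 0
        · simp only [σ, hn, if_true]; exact Real.rpow_pos_of_pos hb _
        · simp only [σ, hn, if_false]; exact hτ0 n
      σ_le := fun n => by
        by_cases hn : n = 0
        · simp only [σ, δ, hn, if_true]
          have h1 : ((1 - S) / (M : ℝ) ^ d) ^ h⁻¹ ≤ ((M : ℝ) ^ (-(d : ℝ))) ^ h⁻¹ := by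
            refine Real.rpow_le_rpow hb.le ?_ (inv_pos.2 hh).le
            rw [Real.rpow_neg hM0'.le, Real.rpow_natCast, div_eq_mul_inv]
            exact mul_le_of_le_one_left (by positivity) (by linarith)
          rw [← Real.rpow_mul hM0'.le] at h1
          have h2 : (M : ℝ) ^ (-(d : ℝ) * h⁻¹) * (M : ℝ) ^ (d / h - 1) = 1 / M := by
            have e : -(d : ℝ) * h⁻¹ + (d / h - 1) = -1 := by
              rw [div_eq_mul_inv]
              ring
            rw [← Real.rpow_add hM0', e, Real.rpow_neg_one, one_div]
          have h3 : (M : ℝ) ^ (-(d : ℝ) * h⁻¹) * (128 * d) ≤ 1 / M :=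
            (mul_le_mul_of_nonneg_left hM (by positivity)).trans_eq h2
          have h4 : 1 / (8 * d * M) = 1 / M / (8 * (d : ℝ)) := by field_simp
          rw [h4, le_div_iff₀ (by positivity)]
          nlinarith
        · simp only [σ, hn, if_false]
          linarith [min_le_left (δ n / 16) (((1 / 2) ^ (n + 1) / (m n : ℝ) ^ d) ^ h⁻¹)] }
  refine ⟨G, G.hasSum_toSystem_ρ ?_, fun n hn => ⟨by simp [G, m, hn], by simp [G, δ, hn]⟩⟩
  have h0 : (G.m 0 : ℝ) ^ d * G.σ 0 ^ h = 1 - S := by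
    simp only [G, m, σ, if_true]
    rw [← Real.rpow_mul hb.le, inv_mul_cancel₀ hh.ne', Real.rpow_one]
    field_simp
  have h1 : HasSum (fun n => (G.m (n + 1) : ℝ) ^ d * G.σ (n + 1) ^ h) S := hsum.hasSum
  have h2 := HasSum.zero_add (f := fun n => (G.m n : ℝ) ^ d * G.σ n ^ h) h1
  rw [h0] at h2
  convert h2 using 1
  ring

end GridData

/-- Up to lower order terms, the logarithm of the covering number at scale `exp (-L)` of a grid
with `exp (a n * n ^ 2)` points per axis and spacing `exp (-n ^ 2)` in dimension `D`. -/
def gridRate (D : ℝ) (a : ℕ → ℝ) (n : ℕ) (L : ℝ) : ℝ := D * (a n * n ^ 2 - max 0 (n ^ 2 - L))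

theorem gridRate_le_add {D : ℝ} (hD : 0 ≤ D) (a : ℕ → ℝ) (n : ℕ) {L L' : ℝ} (h : L' ≤ L) :
    gridRate D a n L ≤ gridRate D a n L' + D * (L - L') := by
  have : max 0 ((n : ℝ) ^ 2 - L') ≤ max 0 ((n : ℝ) ^ 2 - L) + (L - L') :=
    max_le (add_nonneg (le_max_left _ _) (by linarith))
      (by linarith [le_max_right 0 ((n : ℝ) ^ 2 - L)])
  simp only [gridRate]
  nlinarith

namespace GridData

variable {d : ℕ} {G : GridData d} {a : ℕ → ℝ}

theorem exp_gridRate_le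
    (hG : ∀ n ≠ 0, G.m n = ⌊Real.exp (a n * n ^ 2)⌋₊ ∧ G.δ n = Real.exp (-n ^ 2 - n) / (8 * d))
    {n : ℕ} (hn : n ≠ 0) (L : ℝ) :
    Real.exp (gridRate d a n L - d * n) ≤
      (34 * d) ^ d * coveringNumber (range G.point) (Real.exp (-L)) := by
  have hd : (1 : ℝ) ≤ d := Nat.one_le_cast.2 G.pos
  have hm0 := G.m_pos n
  obtain ⟨hm, hδ⟩ := hG n hn
  set e := max 0 ((n : ℝ) ^ 2 - L) with he
  have h1 : Real.exp (a n * n ^ 2) / 2 ≤ G.m n := by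
    have h2 := Nat.lt_floor_add_one (Real.exp (a n * n ^ 2))
    rw [← hm] at h2
    have h3 : (1 : ℝ) ≤ G.m n := Nat.one_le_cast.2 hm0
    linarith
  have h2 : 2 * Real.exp (-L) / G.δ n + 1 ≤ 17 * d * (Real.exp n * Real.exp e) := by
    have h3 : 2 * Real.exp (-L) / G.δ n = 16 * d * (Real.exp n * Real.exp (n ^ 2 - L)) := by
      rw [hδ, ← Real.exp_add, show (n : ℝ) + (n ^ 2 - L) = -L - (-n ^ 2 - n) by ring,
        Real.exp_sub (-L)]
      generalize Real.exp (-n ^ 2 - n : ℝ) = x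
      rw [div_div_eq_mul_div]
      ring
    have h4 : Real.exp (n ^ 2 - L) ≤ Real.exp e := Real.exp_le_exp.2 (le_max_right _ _)
    have h5 : 1 ≤ Real.exp n * Real.exp e := by
      rw [← Real.exp_add]
      exact Real.one_le_exp (add_nonneg n.cast_nonneg (le_max_left _ _))
    have h6 : Real.exp n * Real.exp (n ^ 2 - L) ≤ Real.exp n * Real.exp e := by gcongr
    rw [h3]
    nlinarith
  have h3 := G.le_coveringNumber_range_point n (Real.exp_pos (-L))
  have hδ0 := G.δ_pos n
  have hpos : 0 < 2 * Real.exp (-L) / G.δ n + 1 := by positivity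
  have h4 : Real.exp (a n * n ^ 2 - e - n) / (34 * d) ≤
      G.m n / (2 * Real.exp (-L) / G.δ n + 1) := by
    refine le_trans (le_of_eq ?_) (div_le_div₀ (Nat.cast_nonneg _) h1 hpos h2)
    rw [Real.exp_sub, Real.exp_sub]
    field_simp
    norm_num
  have h5 := (pow_le_pow_left₀ (by positivity) h4 d).trans h3
  rw [div_pow, div_le_iff₀ (by positivity), ← Real.exp_nat_mul] at h5
  rw [mul_comm ((34 * (d : ℝ)) ^ d)]
  refine le_trans (le_of_eq ?_) h5
  congr 1
  simp only [gridRate]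
  ring

theorem coveringNumber_block_le_exp
    (hG : ∀ n ≠ 0, G.m n = ⌊Real.exp (a n * n ^ 2)⌋₊ ∧ G.δ n = Real.exp (-n ^ 2 - n) / (8 * d))
    {n : ℕ} (hn : n ≠ 0) {L V : ℝ} (hV0 : 0 ≤ V) (hV : gridRate d a n L ≤ V) :
    (coveringNumber (G.block n) (Real.exp (-L)) : ℝ) ≤ 2 ^ d * Real.exp V := by
  have hd : (0 : ℝ) < d := Nat.cast_pos.2 G.pos
  obtain ⟨hm, hδ⟩ := hG n hn
  have hm1 : (G.m n : ℝ) ≤ Real.exp (a n * n ^ 2) := by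
    rw [hm]
    exact Nat.floor_le (Real.exp_pos _).le
  rcases le_or_gt ((n : ℝ) ^ 2) L with h | h
  · rw [gridRate, max_eq_left (by linarith), sub_zero] at hV
    calc (coveringNumber (G.block n) (Real.exp (-L)) : ℝ) ≤ (G.m n : ℝ) ^ d := by
          exact_mod_cast G.coveringNumber_block_le_card n (Real.exp_pos _)
      _ ≤ Real.exp (a n * n ^ 2) ^ d := by gcongr
      _ = Real.exp (d * (a n * n ^ 2)) := (Real.exp_nat_mul _ _).symm
      _ ≤ Real.exp V := Real.exp_le_exp.2 hV
      _ ≤ _ := le_mul_of_one_le_left (Real.exp_pos _).le (one_le_pow₀ one_le_two)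
  · rw [gridRate, max_eq_right (by linarith)] at hV
    refine (G.coveringNumber_block_le n (Real.exp_pos _)).trans ?_
    have h1 : d * (G.m n * G.δ n) / Real.exp (-L) + 1 ≤ 2 * Real.exp (V / d) := by
      have h2 : d * (G.m n * G.δ n) / Real.exp (-L) ≤ Real.exp (V / d) := by
        calc d * (G.m n * G.δ n) / Real.exp (-L)
            ≤ d * (Real.exp (a n * n ^ 2) * G.δ n) / Real.exp (-L) := by
              have := (G.δ_pos n).le
              gcongr
          _ = Real.exp (a n * n ^ 2 + (-n ^ 2 - n) - -L) / 8 := by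
              rw [hδ, Real.exp_sub _ (-L), Real.exp_add]
              field_simp
          _ ≤ Real.exp (a n * n ^ 2 + (-n ^ 2 - n) - -L) :=
              div_le_self (Real.exp_pos _).le (by norm_num)
          _ ≤ _ := by
              refine Real.exp_le_exp.2 ((le_div_iff₀ hd).2 ?_)
              have : (0 : ℝ) ≤ n := n.cast_nonneg
              nlinarith
      have h3 : 1 ≤ Real.exp (V / d) := Real.one_le_exp (div_nonneg hV0 hd.le)
      linarith
    have hδ0 := (G.δ_pos n).le
    refine (pow_le_pow_left₀ (by positivity) h1 d).trans_eq ?_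
    rw [mul_pow, ← Real.exp_nat_mul, mul_div_cancel₀ _ hd.ne']

theorem coveringNumber_range_point_le_exp
    (hG : ∀ n ≠ 0, G.m n = ⌊Real.exp (a n * n ^ 2)⌋₊ ∧ G.δ n = Real.exp (-n ^ 2 - n) / (8 * d))
    {L V : ℝ} (hL : 0 ≤ L) (hV0 : 0 ≤ V) (hV : ∀ n ≠ 0, gridRate d a n L ≤ V) :
    (coveringNumber (range G.point) (Real.exp (-L)) : ℝ) ≤
      ((G.m 0 : ℝ) ^ d + 2 ^ d) * (L + 2) * Real.exp V := by
  have h1 := G.coveringNumber_range_point_le (Real.exp_pos (-L)) (N := ⌈L⌉₊)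
    (Real.exp_le_exp.2 (neg_le_neg (Nat.le_ceil L)))
  set C := ((G.m 0 : ℝ) ^ d + 2 ^ d) * Real.exp V with hC
  have hexp : 1 ≤ Real.exp V := Real.one_le_exp hV0
  have h2 : ∀ n ∈ Finset.range ⌈L⌉₊,
      (coveringNumber (G.block n) (Real.exp (-L)) : ℝ) ≤ C := fun n _ => by
    by_cases hn : n = 0
    · subst hn
      calc (coveringNumber (G.block 0) (Real.exp (-L)) : ℝ) ≤ (G.m 0 : ℝ) ^ d := by
            exact_mod_cast G.coveringNumber_block_le_card 0 (Real.exp_pos _)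
        _ ≤ (G.m 0 : ℝ) ^ d * Real.exp V := le_mul_of_one_le_right (by positivity) hexp
        _ ≤ C := by
            rw [hC, add_mul]
            exact le_add_of_nonneg_right (by positivity)
    · refine (coveringNumber_block_le_exp hG hn hV0 (hV n hn)).trans ?_
      rw [hC, add_mul]
      exact le_add_of_nonneg_left (by positivity)
  have h3 : (coveringNumber (range G.point) (Real.exp (-L)) : ℝ) ≤ 1 + ⌈L⌉₊ * C := by
    refine (Nat.cast_le.2 h1).trans ?_
    push_cast
    refine add_le_add_right ((Finset.sum_le_card_nsmul _ _ _ h2).trans_eq (by simp)) _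
  have h4 : 1 ≤ C := by
    have h5 : (1 : ℝ) ≤ (G.m 0 : ℝ) ^ d + 2 ^ d :=
      (one_le_pow₀ one_le_two).trans (le_add_of_nonneg_left (by positivity))
    rw [hC]
    nlinarith
  have h5 := Nat.ceil_lt_add_one hL
  calc _ ≤ _ := h3
    _ ≤ (L + 2) * C := by nlinarith
    _ = _ := by rw [hC]; ring

theorem exp_gridRate_add_le_coveringNumber_Λ {h h' : ℝ}
    (hG : ∀ n ≠ 0, G.m n = ⌊Real.exp (a n * n ^ 2)⌋₊ ∧ G.δ n = Real.exp (-n ^ 2 - n) / (8 * d))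
    (hsum : HasSum (fun i => G.toSystem.ρ i ^ h) 1) (h0 : 0 < h') (hlt : h' < h) :
    ∃ C : ℝ, 0 < C ∧ ∀ n ≠ 0, ∀ L' L : ℝ, 0 ≤ L' → L' ≤ L →
      Real.exp (gridRate d a n L' + h' * (L - L') - d * n) ≤
        C * coveringNumber G.toSystem.Λ (Real.exp (-L)) := by
  obtain ⟨c, hc, H⟩ := G.toSystem.exists_le_coveringNumber_Λ hsum h0 hlt
  have hd : (0 : ℝ) < d := Nat.cast_pos.2 G.pos
  refine ⟨(34 * d) ^ d / c, by positivity, fun n hn L' L hL' hL => ?_⟩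
  have h1 := H (Real.exp (-L')) (Real.exp_pos _) (Real.exp_le_one_iff.2 (by linarith))
    (Real.exp (-(L - L'))) (Real.exp_pos _) (Real.exp_le_one_iff.2 (by linarith))
  have h2 := exp_gridRate_le hG hn L'
  rw [← Real.exp_add, show -L' + -(L - L') = -L by ring, ← Real.exp_mul] at h1
  have h3 : Real.exp (gridRate d a n L' + h' * (L - L') - d * n) =
      Real.exp (-(L - L') * -h') * Real.exp (gridRate d a n L' - d * n) := by
    rw [← Real.exp_add]
    congr 1
    ring
  rw [h3, div_mul_eq_mul_div, le_div_iff₀ hc]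
  calc _ ≤ Real.exp (-(L - L') * -h') * ((34 * d) ^ d *
        coveringNumber (range G.point) (Real.exp (-L'))) * c := by gcongr
    _ = (34 * d) ^ d * (c * (Real.exp (-(L - L') * -h') *
        coveringNumber (range G.point) (Real.exp (-L')))) := by ring
    _ ≤ _ := mul_le_mul_of_nonneg_left h1 (by positivity)

theorem coveringNumber_Λ_le_exp {h : ℝ} (hh : 0 < h)
    (hG : ∀ n ≠ 0, G.m n = ⌊Real.exp (a n * n ^ 2)⌋₊ ∧ G.δ n = Real.exp (-n ^ 2 - n) / (8 * d))
    (hsum : HasSum (fun i => G.toSystem.ρ i ^ h) 1) {L V : ℝ} (hL : 0 ≤ L) (hLV : h * L ≤ V)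
    (hV : ∀ n ≠ 0, ∀ L' ∈ Icc 0 L, gridRate d a n L' + h * (L - L') ≤ V) :
    (coveringNumber G.toSystem.Λ (Real.exp (-L)) : ℝ) ≤
      ((G.m 0 : ℝ) ^ d + 2 ^ d) * Real.exp ((h + d) * Real.log 4) * (L + 4) ^ 2 * Real.exp V := by
  have hd : (0 : ℝ) < d := Nat.cast_pos.2 G.pos
  have h4 : 0 < Real.log 4 := Real.log_pos (by norm_num)
  have h4' : Real.log 4 ≤ 2 := by
    rw [Real.log_le_iff_le_exp (by norm_num)]
    have h1 : (2 : ℝ) ≤ Real.exp 1 := by linarith [Real.add_one_le_exp (1 : ℝ)]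
    rw [show (2 : ℝ) = 1 + 1 by norm_num, Real.exp_add]
    nlinarith
  set C := ((G.m 0 : ℝ) ^ d + 2 ^ d) with hC
  have hC0 : 0 < C := by positivity
  have hW : ∀ τ, Real.exp (-L) / 4 < τ → τ ≤ 1 →
      (coveringNumber (range G.toSystem.p) (Real.exp (-L) / τ / 4) : ℝ) ≤
        τ ^ h * (C * (L + 4) * Real.exp (V + (h + d) * Real.log 4)) := by
    intro τ hτ hτ1
    have hτ0 : 0 < τ := lt_trans (by positivity) hτ
    have hlog : -L - Real.log 4 < Real.log τ := by
      have := Real.log_lt_log (by positivity) hτ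
      rwa [Real.log_div (Real.exp_pos _).ne' (by norm_num), Real.log_exp] at this
    have hlog0 : Real.log τ ≤ 0 := Real.log_nonpos hτ0.le hτ1
    have e : Real.exp (-L) / τ / 4 = Real.exp (-(L + Real.log τ + Real.log 4)) := by
      rw [neg_add, neg_add, Real.exp_add, Real.exp_add, Real.exp_neg (Real.log τ),
        Real.exp_neg (Real.log 4), Real.exp_log hτ0, Real.exp_log (by norm_num)]
      ring
    rw [e]
    have h1 := coveringNumber_range_point_le_exp hG
      (L := L + Real.log τ + Real.log 4) (V := V + h * Real.log τ + (h + d) * Real.log 4)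
      (by linarith) (by nlinarith) (fun n hn => by
        have hL'0 : 0 ≤ max 0 (L + Real.log τ) := le_max_left _ _
        have hL'1 : max 0 (L + Real.log τ) ≤ L + Real.log τ + Real.log 4 :=
          max_le (by linarith) (by linarith)
        have hL'2 : max 0 (L + Real.log τ) ≤ L := max_le hL (by linarith)
        have h2 := hV n hn _ ⟨hL'0, hL'2⟩
        have h3 := gridRate_le_add hd.le a n hL'1
        have h5 : L + Real.log τ ≤ max 0 (L + Real.log τ) := le_max_right _ _
        nlinarith)
    refine h1.trans ?_
    have e2 : Real.exp (V + h * Real.log τ + (h + d) * Real.log 4) =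
        τ ^ h * Real.exp (V + (h + d) * Real.log 4) := by
      rw [Real.rpow_def_of_pos hτ0, ← Real.exp_add]
      congr 1
      ring
    rw [e2]
    calc C * (L + Real.log τ + Real.log 4 + 2) * (τ ^ h * Real.exp (V + (h + d) * Real.log 4))
        ≤ C * (L + 4) * (τ ^ h * Real.exp (V + (h + d) * Real.log 4)) := by
          refine mul_le_mul_of_nonneg_right (mul_le_mul_of_nonneg_left ?_ hC0.le) (by positivity)
          linarith
      _ = _ := by ring
  have hn : 2 * (1 / 16 : ℝ) ^ (⌈L⌉₊ + 1) ≤ Real.exp (-L) := by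
    have h1 : (1 / 16 : ℝ) ≤ Real.exp (-1) := by
      rw [Real.exp_neg, one_div]
      exact inv_anti₀ (Real.exp_pos _) (by linarith [Real.exp_one_lt_d9])
    have h2 : (1 / 16 : ℝ) ^ ⌈L⌉₊ ≤ Real.exp (-L) := by
      refine (pow_le_pow_left₀ (by norm_num) h1 _).trans ?_
      rw [← Real.exp_nat_mul]
      exact Real.exp_le_exp.2 (by linarith [Nat.le_ceil L])
    rw [pow_succ]
    linarith [Real.exp_pos (-L)]
  have h1 := G.toSystem.coveringNumber_Λ_le hh hsum (Real.exp_pos (-L)) hW (⌈L⌉₊ + 1) 1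
    (by linarith [Real.exp_pos (-L), Real.exp_le_one_iff.2 (neg_nonpos.2 hL)]) le_rfl
    (by rwa [div_one])
  rw [div_one, Real.one_rpow, one_mul] at h1
  refine h1.trans ?_
  have h2 := Nat.ceil_lt_add_one hL
  push_cast
  calc ((⌈L⌉₊ : ℝ) + 1 + 1) * (C * (L + 4) * Real.exp (V + (h + d) * Real.log 4))
      ≤ (L + 4) * (C * (L + 4) * Real.exp (V + (h + d) * Real.log 4)) := by
        refine mul_le_mul_of_nonneg_right ?_ (by positivity)
        linarith
    _ = _ := by
        rw [Real.exp_add]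
        ring

end GridData

/-! ### Box dimensions along exponential scales -/

section BoxDim

variable {α : Type*} [PseudoMetricSpace α] {E : Set α} {x L : ℝ}

theorem map_exp_neg_atTop : map (fun L : ℝ => Real.exp (-L)) atTop = 𝓝[>] (0 : ℝ) := by
  rw [← Real.map_exp_atBot, ← map_neg_atTop, map_map]
  rfl

theorem dimLB_eq_liminf (E : Set α) :
    dimLB E = liminf (fun L : ℝ => sFun E (Real.exp (-L))) atTop := by
  simp only [dimLB, ← map_exp_neg_atTop, liminf, map_map, Function.comp_def]

theorem dimUB_eq_limsup (E : Set α) :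
    dimUB E = limsup (fun L : ℝ => sFun E (Real.exp (-L))) atTop := by
  simp only [dimUB, ← map_exp_neg_atTop, limsup, map_map, Function.comp_def]

theorem sFun_exp_neg (E : Set α) (L : ℝ) :
    sFun E (Real.exp (-L)) = Real.log (coveringNumber E (Real.exp (-L))) / L := by
  rw [sFun, one_div, Real.log_inv, Real.log_exp, neg_neg]

theorem sFun_exp_neg_le (hL : 0 < L) (h0 : 0 < coveringNumber E (Real.exp (-L)))
    (h : (coveringNumber E (Real.exp (-L)) : ℝ) ≤ Real.exp (x * L)) :
    sFun E (Real.exp (-L)) ≤ x := by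
  rw [sFun_exp_neg, div_le_iff₀ hL]
  exact (Real.log_le_iff_le_exp (Nat.cast_pos.2 h0)).2 h

theorem le_sFun_exp_neg (hL : 0 < L) (h0 : 0 < coveringNumber E (Real.exp (-L)))
    (h : Real.exp (x * L) ≤ coveringNumber E (Real.exp (-L))) :
    x ≤ sFun E (Real.exp (-L)) := by
  rw [sFun_exp_neg, le_div_iff₀ hL]
  exact (Real.le_log_iff_exp_le (Nat.cast_pos.2 h0)).2 h

theorem dimLB_eq_of_exp_le (h0 : ∀ L : ℝ, 0 < coveringNumber E (Real.exp (-L)))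
    (h1 : ∀ ε > 0, ∀ᶠ L : ℝ in atTop,
      Real.exp ((x - ε) * L) ≤ coveringNumber E (Real.exp (-L)))
    (h2 : ∀ ε > 0, ∃ᶠ L : ℝ in atTop,
      (coveringNumber E (Real.exp (-L)) : ℝ) ≤ Real.exp ((x + ε) * L)) : dimLB E = x := by
  have h1' : ∀ ε > 0, ∀ᶠ L : ℝ in atTop, x - ε ≤ sFun E (Real.exp (-L)) := fun ε hε => by
    filter_upwards [h1 ε hε, eventually_gt_atTop 0] with L hL hL0 using le_sFun_exp_neg hL0 (h0 L) hL
  have h2' : ∀ ε > 0, ∃ᶠ L : ℝ in atTop, sFun E (Real.exp (-L)) ≤ x + ε := fun ε hε =>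
    ((h2 ε hε).and_eventually (eventually_gt_atTop 0)).mono fun L hL =>
      sFun_exp_neg_le hL.2 (h0 L) hL.1
  rw [dimLB_eq_liminf]
  refine le_antisymm (le_of_forall_pos_le_add fun ε hε => ?_)
    (le_of_forall_pos_le_add fun ε hε => ?_)
  · exact liminf_le_of_frequently_le (h2' ε hε) ⟨_, eventually_map.2 (h1' 1 one_pos)⟩
  · rw [← sub_le_iff_le_add]
    exact le_liminf_of_le (IsCoboundedUnder.of_frequently_le (h2' 1 one_pos)) (h1' ε hε)

theorem dimUB_eq_of_exp_le (h0 : ∀ L : ℝ, 0 < coveringNumber E (Real.exp (-L)))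
    (h1 : ∀ ε > 0, ∀ᶠ L : ℝ in atTop,
      (coveringNumber E (Real.exp (-L)) : ℝ) ≤ Real.exp ((x + ε) * L))
    (h2 : ∀ ε > 0, ∃ᶠ L : ℝ in atTop,
      Real.exp ((x - ε) * L) ≤ coveringNumber E (Real.exp (-L))) : dimUB E = x := by
  have h1' : ∀ ε > 0, ∀ᶠ L : ℝ in atTop, sFun E (Real.exp (-L)) ≤ x + ε := fun ε hε => by
    filter_upwards [h1 ε hε, eventually_gt_atTop 0] with L hL hL0 using sFun_exp_neg_le hL0 (h0 L) hL
  have h2' : ∀ ε > 0, ∃ᶠ L : ℝ in atTop, x - ε ≤ sFun E (Real.exp (-L)) := fun ε hε =>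
    ((h2 ε hε).and_eventually (eventually_gt_atTop 0)).mono fun L hL =>
      le_sFun_exp_neg hL.2 (h0 L) hL.1
  rw [dimUB_eq_limsup]
  refine le_antisymm (le_of_forall_pos_le_add fun ε hε => ?_)
    (le_of_forall_pos_le_add fun ε hε => ?_)
  · exact limsup_le_of_le (IsCoboundedUnder.of_frequently_ge (h2' 1 one_pos)) (h1' ε hε)
  · rw [← sub_le_iff_le_add]
    exact le_limsup_of_frequently_le (h2' ε hε) ⟨_, eventually_map.2 (h1' 1 one_pos)⟩

end BoxDim

theorem eventually_mul_sq_le_exp {C ε : ℝ} (hC : 0 < C) (hε : 0 < ε) :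
    ∀ᶠ L : ℝ in atTop, C * (L + 4) ^ 2 ≤ Real.exp (ε * L) := by
  have h := (isLittleO_pow_exp_pos_mul_atTop 2 hε).bound
    (show (0 : ℝ) < 1 / (25 * C) by positivity)
  filter_upwards [h, eventually_ge_atTop 1] with L hL hL1
  rw [Real.norm_of_nonneg (by positivity), Real.norm_of_nonneg (Real.exp_pos _).le,
    div_mul_eq_mul_div, le_div_iff₀ (by positivity), one_mul] at hL
  refine le_trans ?_ hL
  nlinarith [mul_nonneg hC.le (show 0 ≤ 25 * L ^ 2 - (L + 4) ^ 2 by nlinarith)]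

/-- The requirements on the exponents `a` of a sequence of grids ensuring that the associated
iterated function system has the prescribed dimensions. -/
structure IsGridExponent (D h s t β : ℝ) (a : ℕ → ℝ) : Prop where
  nonneg : ∀ n, 0 ≤ a n
  mul_le : ∀ n, D * a n ≤ t
  eventually_le : ∀ ε > 0, ∀ᶠ L : ℝ in atTop, ∃ n ≠ 0, (s - ε) * L ≤ gridRate D a n L - D * n
  frequently_ge : ∀ ε > 0, ∃ᶠ L : ℝ in atTop, ∃ n ≠ 0, (t - ε) * L ≤ gridRate D a n L - D * n
  frequently_le : ∀ ε > 0, ∃ᶠ L : ℝ in atTop, ∀ n ≠ 0, gridRate D a n L ≤ (s + ε) * L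
  eventually_le_max : ∀ ε > 0, ∀ᶠ L : ℝ in atTop, ∃ n ≠ 0, ∃ L' ∈ Icc 0 L,
    (β - ε) * L ≤ gridRate D a n L' + h * (L - L') - D * n
  frequently_max_le : ∀ ε > 0, ∃ᶠ L : ℝ in atTop, ∀ n ≠ 0, ∀ L' ∈ Icc 0 L,
    gridRate D a n L' + h * (L - L') ≤ (β + ε) * L

theorem gridRate_le_mul {D t : ℝ} (hD : t ≤ D) {a : ℕ → ℝ} (n : ℕ)
    (ha : D * a n ≤ t) (ht : 0 ≤ t) (L : ℝ) : gridRate D a n L ≤ t * L := by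
  have h1 : D * a n * n ^ 2 ≤ t * n ^ 2 := mul_le_mul_of_nonneg_right ha (sq_nonneg _)
  have h2 := mul_le_mul_of_nonneg_right hD (le_max_left 0 ((n : ℝ) ^ 2 - L))
  have h3 := mul_le_mul_of_nonneg_left (le_max_right 0 ((n : ℝ) ^ 2 - L)) ht
  simp only [gridRate]
  linarith

namespace IsGridExponent

variable {d : ℕ} {h s t β : ℝ} {a : ℕ → ℝ}

theorem exists_CIFS (ha : IsGridExponent d h s t β a) (hd : 0 < d) (hh : 0 < h) (hhd : h < d)
    (hs : 0 ≤ s) (hst : s ≤ t) (htd : t ≤ d) (hβ : h ≤ β) :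
    ∃ Phi : CIFS d,
      (∀ i : Phi.I, ∃ r : ℝ, 0 < r ∧ r < 1 ∧
        ∀ x y, dist (Phi.S i x) (Phi.S i y) = r * dist x y) ∧
      (dimH Phi.limitSet).toReal = h ∧ dimLB Phi.fixedPoints = s ∧
      dimUB Phi.fixedPoints = t ∧ dimLB Phi.limitSet = β := by
  have hd' : (0 : ℝ) < d := Nat.cast_pos.2 hd
  obtain ⟨G, hsum, hG⟩ := GridData.exists_hasSum_one hd hh hhd ha.nonneg fun n => by
    have := ha.mul_le n
    nlinarith
  have ht : 0 ≤ t := hs.trans hst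
  have hneF : (range G.point).Nonempty := G.toSystem.nonempty.elim fun i => ⟨_, mem_range_self i⟩
  have hneΛ : G.toSystem.Λ.Nonempty := hneF.mono G.toSystem.range_p_subset_Λ
  have hF0 : ∀ L : ℝ, 0 < coveringNumber (range G.point) (Real.exp (-L)) := fun L =>
    one_le_coveringNumber G.isBounded_range_point hneF (Real.exp_pos _)
  have hΛ0 : ∀ L : ℝ, 0 < coveringNumber G.toSystem.Λ (Real.exp (-L)) := fun L =>
    one_le_coveringNumber G.toSystem.isBounded_Λ hneΛ (Real.exp_pos _)
  have lower : ∀ {C ε x L y N : ℝ}, 0 < C → 0 ≤ L → C * (L + 4) ^ 2 ≤ Real.exp (ε / 2 * L) →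
      (x - ε / 2) * L ≤ y → Real.exp y ≤ C * N → Real.exp ((x - ε) * L) ≤ N := by
    intro C ε x L y N hC hL h1 h2 h3
    have h4 : C ≤ Real.exp (ε / 2 * L) := by
      refine le_trans ?_ h1
      nlinarith [mul_nonneg hC.le hL, mul_nonneg hC.le (mul_nonneg hL hL)]
    have h5 : C * Real.exp ((x - ε) * L) ≤ Real.exp ((x - ε / 2) * L) := by
      refine (mul_le_mul_of_nonneg_right h4 (Real.exp_pos _).le).trans_eq ?_
      rw [← Real.exp_add]
      congr 1
      ring
    exact le_of_mul_le_mul_left ((h5.trans (Real.exp_le_exp.2 h2)).trans h3) hC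
  have upper : ∀ {C ε x L N : ℝ}, C * (L + 4) ^ 2 ≤ Real.exp (ε / 2 * L) →
      N ≤ C * (L + 4) ^ 2 * Real.exp ((x + ε / 2) * L) → N ≤ Real.exp ((x + ε) * L) := by
    intro C ε x L N h1 h2
    refine (h2.trans (mul_le_mul_of_nonneg_right h1 (Real.exp_pos _).le)).trans_eq ?_
    rw [← Real.exp_add]
    congr 1
    ring
  have hCl : (0 : ℝ) < (34 * d) ^ d := by positivity
  have hCu : (0 : ℝ) < (G.m 0 : ℝ) ^ d + 2 ^ d := by positivity
  have upperF : ∀ {x L : ℝ}, 0 ≤ x → 0 ≤ L → (∀ n ≠ 0, gridRate d a n L ≤ x * L) →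
      (coveringNumber (range G.point) (Real.exp (-L)) : ℝ) ≤
        ((G.m 0 : ℝ) ^ d + 2 ^ d) * (L + 4) ^ 2 * Real.exp (x * L) := by
    intro x L hx hL hV
    refine (GridData.coveringNumber_range_point_le_exp hG hL (mul_nonneg hx hL) hV).trans ?_
    gcongr
    nlinarith
  refine ⟨G.toSystem.toCIFS, fun i => ⟨G.toSystem.ρ i, G.toSystem.ρ_pos i,
    (G.toSystem.ρ_le i).trans_lt (by norm_num), G.toSystem.dist_map i⟩, ?_, ?_, ?_, ?_⟩
  · change (dimH G.toSystem.Λ).toReal = h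
    rw [G.toSystem.dimH_Λ hh hsum, ENNReal.toReal_ofReal hh.le]
  · rw [G.toSystem.fixedPoints_toCIFS]
    refine dimLB_eq_of_exp_le hF0 (fun ε hε => ?_) fun ε hε => ?_
    · filter_upwards [ha.eventually_le (ε / 2) (half_pos hε),
        eventually_mul_sq_le_exp hCl (half_pos hε), eventually_ge_atTop 0] with L ⟨n, hn, hL⟩ h1 h2
      exact lower hCl h2 h1 hL (GridData.exp_gridRate_le hG hn L)
    · refine ((ha.frequently_le (ε / 2) (half_pos hε)).and_eventually
        ((eventually_mul_sq_le_exp hCu (half_pos hε)).and (eventually_ge_atTop 0))).mono ?_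
      rintro L ⟨h1, h2, h3⟩
      exact upper h2 (upperF (by linarith) h3 h1)
  · rw [G.toSystem.fixedPoints_toCIFS]
    refine dimUB_eq_of_exp_le hF0 (fun ε hε => ?_) fun ε hε => ?_
    · filter_upwards [eventually_mul_sq_le_exp hCu (half_pos hε), eventually_ge_atTop 0]
        with L h2 h3
      refine upper h2 (upperF (by linarith) h3 fun n _ => ?_)
      refine (gridRate_le_mul htd n (ha.mul_le n) ht L).trans ?_
      gcongr
      linarith
    · refine ((ha.frequently_ge (ε / 2) (half_pos hε)).and_eventually
        ((eventually_mul_sq_le_exp hCl (half_pos hε)).and (eventually_ge_atTop 0))).mono ?_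
      rintro L ⟨⟨n, hn, h1⟩, h2, h3⟩
      exact lower hCl h3 h2 h1 (GridData.exp_gridRate_le hG hn L)
  · change dimLB G.toSystem.Λ = β
    refine dimLB_eq_of_exp_le hΛ0 (fun ε hε => ?_) fun ε hε => ?_
    · set h' := max (h / 2) (h - ε / 4) with hh'
      obtain ⟨C, hC, H⟩ := GridData.exp_gridRate_add_le_coveringNumber_Λ hG hsum
        (h' := h') (lt_max_of_lt_left (half_pos hh)) (max_lt (by linarith) (by linarith))
      filter_upwards [ha.eventually_le_max (ε / 4) (by linarith),
        eventually_mul_sq_le_exp hC (half_pos hε), eventually_ge_atTop 0]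
        with L ⟨n, hn, L', hL', h1⟩ h2 h3
      refine lower hC h3 h2 ?_ (H n hn L' L hL'.1 hL'.2)
      have h4 : (h - ε / 4) * (L - L') ≤ h' * (L - L') :=
        mul_le_mul_of_nonneg_right (le_max_right _ _) (by linarith [hL'.2])
      nlinarith [hL'.1, mul_nonneg hε.le hL'.1]
    · have hC : 0 < ((G.m 0 : ℝ) ^ d + 2 ^ d) * Real.exp ((h + d) * Real.log 4) := by positivity
      refine ((ha.frequently_max_le (ε / 2) (half_pos hε)).and_eventually
        ((eventually_mul_sq_le_exp hC (half_pos hε)).and (eventually_ge_atTop 0))).mono ?_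
      rintro L ⟨h1, h2, h3⟩
      refine upper h2 (GridData.coveringNumber_Λ_le_exp hh hG hsum h3 ?_ h1)
      gcongr
      linarith

end IsGridExponent

/-! ### Exponents with sparse peaks, each followed by a gap -/

/-- The positions of the peaks. -/
def peak (k : ℕ) : ℕ := 2 ^ k ^ 2

/-- The index of the last peak up to `n`. -/
def peakIndex (n : ℕ) : ℕ := Nat.sqrt (Nat.log 2 n)

theorem peak_pos (k : ℕ) : 0 < peak k := by unfold peak; positivity

theorem peak_le_iff {k n : ℕ} (hn : n ≠ 0) : peak k ≤ n ↔ k ≤ peakIndex n := by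
  rw [peak, peakIndex, ← Nat.le_log_iff_pow_le one_lt_two hn, Nat.le_sqrt']

theorem peakIndex_eq {k n : ℕ} (h1 : peak k ≤ n) (h2 : n < peak (k + 1)) : peakIndex n = k := by
  have hn : n ≠ 0 := ((peak_pos k).trans_le h1).ne'
  have h3 := (peak_le_iff hn).1 h1
  have h4 := (peak_le_iff hn).not.1 h2.not_ge
  omega

theorem peak_strictMono : StrictMono peak := fun _ _ h =>
  Nat.pow_lt_pow_right one_lt_two (Nat.pow_lt_pow_left h two_ne_zero)

theorem two_mul_sq_mul_peak_le (k : ℕ) : 2 * (k + 1) ^ 2 * peak k ≤ peak (k + 1) := by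
  have h1 : k + 1 ≤ 2 ^ k := Nat.lt_two_pow_self
  have h2 : peak (k + 1) = 2 * (2 ^ k) ^ 2 * peak k := by
    rw [peak, peak, ← pow_mul, ← pow_succ', ← pow_add]
    congr 1
    ring
  rw [h2]
  gcongr

/-- The height of the `k`-th peak. -/
def peakHeight (D t b : ℝ) (k : ℕ) : ℝ := max b (t - (D - b) / (k + 1))

/-- The sequence with value `peakHeight D t b k` at `peak k`, value `0` at larger `n` with
`n ^ 2 < κ k * peak k ^ 2`, and value `b` elsewhere. -/
def peakExponent (D t b : ℝ) (κ : ℕ → ℝ) (n : ℕ) : ℝ :=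
  if n = peak (peakIndex n) then peakHeight D t b (peakIndex n)
  else if (n : ℝ) ^ 2 < κ (peakIndex n) * (peak (peakIndex n) : ℝ) ^ 2 then 0 else b

section PeakExponent

variable {D t b : ℝ} {κ : ℕ → ℝ}

theorem peakExponent_peak (k : ℕ) : peakExponent D t b κ (peak k) = peakHeight D t b k := by
  rw [peakExponent, peakIndex_eq le_rfl (peak_strictMono k.lt_succ_self), if_pos rfl]

theorem peakExponent_of_le {k n : ℕ} (h1 : peak k < n) (h2 : n < peak (k + 1))
    (h3 : κ k * (peak k : ℝ) ^ 2 ≤ (n : ℝ) ^ 2) : peakExponent D t b κ n = b := by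
  rw [peakExponent, peakIndex_eq h1.le h2, if_neg h1.ne', if_neg h3.not_gt]

theorem peakExponent_of_lt {k n : ℕ} (h1 : peak k < n) (h2 : n < peak (k + 1))
    (h3 : (n : ℝ) ^ 2 < κ k * (peak k : ℝ) ^ 2) : peakExponent D t b κ n = 0 := by
  rw [peakExponent, peakIndex_eq h1.le h2, if_neg h1.ne', if_pos h3]

theorem peak_cases {n : ℕ} (hn : n ≠ 0) :
    (∃ k, n = peak k) ∨ ∃ k, peak k < n ∧ n < peak (k + 1) := by
  have h1 : peak (peakIndex n) ≤ n := (peak_le_iff hn).2 le_rfl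
  have h2 : n < peak (peakIndex n + 1) := lt_of_not_ge fun h => by
    have := (peak_le_iff hn).1 h
    omega
  rcases h1.eq_or_lt with h | h
  · exact Or.inl ⟨_, h.symm⟩
  · exact Or.inr ⟨_, h, h2⟩

theorem le_peakHeight (k : ℕ) : b ≤ peakHeight D t b k := le_max_left _ _

theorem peakHeight_le (hbt : b ≤ t) (hbD : b ≤ D) (k : ℕ) : peakHeight D t b k ≤ t :=
  max_le hbt (sub_le_self _ (div_nonneg (sub_nonneg.2 hbD) (by positivity)))

theorem le_peakHeight_add (hb : 0 ≤ b) (k : ℕ) : t ≤ peakHeight D t b k + D / (k + 1) := by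
  have h1 : t - (D - b) / (k + 1) ≤ peakHeight D t b k := le_max_right _ _
  have h2 : (D - b) / (k + 1) ≤ D / (k + 1) := by gcongr; linarith
  linarith

theorem div_le_sub_peakHeight (htD : t ≤ D) (hbD : b ≤ D) (k : ℕ) :
    (D - b) / (k + 1) ≤ D - peakHeight D t b k := by
  have h1 : (D - b) / (k + 1) ≤ D - b :=
    div_le_self (sub_nonneg.2 hbD) (by linarith [(k.cast_nonneg : (0 : ℝ) ≤ k)])
  rw [peakHeight, le_sub_comm]
  exact max_le (by linarith) (by linarith)

theorem peakExponent_nonneg (hb : 0 ≤ b) (n : ℕ) : 0 ≤ peakExponent D t b κ n := by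
  unfold peakExponent
  split_ifs
  · exact hb.trans (le_peakHeight _)
  · exact le_rfl
  · exact hb

theorem peakExponent_le (hb : 0 ≤ b) (hbt : b ≤ t) (hbD : b ≤ D) (n : ℕ) :
    peakExponent D t b κ n ≤ t := by
  unfold peakExponent
  split_ifs
  · exact peakHeight_le hbt hbD _
  · exact hb.trans hbt
  · exact hbt

/-- Late peaks are too far away to be seen at the scales attached to earlier peaks. -/
theorem eventually_mul_sq_peak_le (htD : t ≤ D) (hbD : b < D) :
    ∀ᶠ k in atTop, ∀ j > k,
      D * ((k + 2) * (peak k : ℝ) ^ 2) ≤ (D - peakHeight D t b j) * (peak j : ℝ) ^ 2 := by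
  filter_upwards [tendsto_natCast_atTop_atTop.eventually_ge_atTop (D / (D - b))] with k hk j hj
  obtain ⟨i, rfl⟩ : ∃ i, j = i + 1 := ⟨j - 1, by omega⟩
  have hki : (k : ℝ) ≤ i := Nat.cast_le.2 (by omega)
  have hDb : 0 < D - b := sub_pos.2 hbD
  rw [div_le_iff₀ hDb] at hk
  have h1 := div_le_sub_peakHeight htD hbD.le (i + 1)
  have h2 : (peak k : ℝ) ≤ peak i := Nat.cast_le.2 (peak_strictMono.monotone (by omega))
  have h3 : 2 * ((i : ℝ) + 1) ^ 2 * peak i ≤ peak (i + 1) := by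
    exact_mod_cast two_mul_sq_mul_peak_le i
  have h4 : (2 * ((i : ℝ) + 1) ^ 2 * peak k) ^ 2 ≤ (peak (i + 1) : ℝ) ^ 2 := by
    refine pow_le_pow_left₀ (by positivity) (le_trans ?_ h3) 2
    gcongr
  have hi : (0 : ℝ) ≤ i := i.cast_nonneg
  have hk0 : (0 : ℝ) ≤ k := k.cast_nonneg
  have h5 : D * (k + 2) ≤ (D - b) / ((i + 1 : ℕ) + 1) * (2 * ((i : ℝ) + 1) ^ 2) ^ 2 := by
    push_cast
    rw [div_mul_eq_mul_div, le_div_iff₀ (by positivity)]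
    have h6 : D ≤ (D - b) * (i + 1) := by nlinarith
    calc D * (k + 2) * ((i : ℝ) + 1 + 1) ≤ (D - b) * (i + 1) * (k + 2) * ((i : ℝ) + 1 + 1) := by
          gcongr
      _ ≤ (D - b) * (i + 1) * (2 * (i + 1)) * (2 * (i + 1)) := by
          have : (0 : ℝ) ≤ (D - b) * (i + 1) := by positivity
          gcongr <;> linarith
      _ = (D - b) * (4 * (i + 1) ^ 3) := by ring
      _ ≤ (D - b) * (2 * (i + 1) ^ 2) ^ 2 := by
          gcongr
          nlinarith [pow_nonneg (by linarith : (0 : ℝ) ≤ i + 1) 3]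
  calc D * ((k + 2) * (peak k : ℝ) ^ 2) = D * (k + 2) * (peak k : ℝ) ^ 2 := by ring
    _ ≤ (D - b) / ((i + 1 : ℕ) + 1) * (2 * ((i : ℝ) + 1) ^ 2) ^ 2 * (peak k : ℝ) ^ 2 := by gcongr
    _ = (D - b) / ((i + 1 : ℕ) + 1) * (2 * ((i : ℝ) + 1) ^ 2 * peak k) ^ 2 := by ring
    _ ≤ (D - peakHeight D t b (i + 1)) * (peak (i + 1) : ℝ) ^ 2 :=
      mul_le_mul h1 h4 (by positivity) ((by positivity : (0 : ℝ) ≤ _).trans h1)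

end PeakExponent

/-! ### Elementary properties of the rate -/

section Rate

variable {D : ℝ} {c : ℕ → ℝ} {n : ℕ} {L : ℝ}

theorem gridRate_div_le (hD : 0 < D) : gridRate D (fun n => c n / D) n L ≤ c n * n ^ 2 := by
  have e : D * (c n / D) = c n := mul_div_cancel₀ _ hD.ne'
  have := mul_nonneg hD.le (le_max_left 0 ((n : ℝ) ^ 2 - L))
  rw [gridRate, mul_sub, ← mul_assoc, e]
  linarith

theorem gridRate_div_le' (hD : 0 < D) :
    gridRate D (fun n => c n / D) n L ≤ D * L - (D - c n) * n ^ 2 := by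
  have e : D * (c n / D) = c n := mul_div_cancel₀ _ hD.ne'
  have := mul_le_mul_of_nonneg_left (le_max_right 0 ((n : ℝ) ^ 2 - L)) hD.le
  rw [gridRate, mul_sub, ← mul_assoc, e]
  linarith

theorem gridRate_div_of_le (hD : 0 < D) (h : (n : ℝ) ^ 2 ≤ L) :
    gridRate D (fun n => c n / D) n L = c n * n ^ 2 := by
  rw [gridRate, max_eq_left (by linarith), sub_zero, ← mul_assoc, mul_div_cancel₀ _ hD.ne']

theorem gridRate_div_of_ge (hD : 0 < D) (h : L ≤ (n : ℝ) ^ 2) :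
    gridRate D (fun n => c n / D) n L = D * L - (D - c n) * n ^ 2 := by
  have e : D * (c n / D) = c n := mul_div_cancel₀ _ hD.ne'
  rw [gridRate, max_eq_right (by linarith), mul_sub, ← mul_assoc, e]
  ring

theorem eventually_mul_sqrt_le (K : ℝ) {ε : ℝ} (hε : 0 < ε) :
    ∀ᶠ L : ℝ in atTop, K * (√L + 1) ≤ ε * L := by
  have h : Tendsto (fun L : ℝ => ε * √L) atTop atTop :=
    Real.tendsto_sqrt_atTop.const_mul_atTop hε
  filter_upwards [h.eventually_ge_atTop (2 * |K|), eventually_ge_atTop 1] with L h1 h2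
  have h3 : 1 ≤ √L := Real.one_le_sqrt.2 h2
  have h4 := Real.mul_self_sqrt (zero_le_one.trans h2)
  nlinarith [le_abs_self K, abs_nonneg K]

/-- The index of the grid of spacing closest to `exp (-L)`. -/
theorem floor_sqrt_bounds (hL : 1 ≤ L) : ⌊√L⌋₊ ≠ 0 ∧ (⌊√L⌋₊ : ℝ) ≤ √L ∧
    (⌊√L⌋₊ : ℝ) ^ 2 ≤ L ∧ L < ((⌊√L⌋₊ : ℝ) + 1) ^ 2 ∧ L ≤ (⌊√L⌋₊ : ℝ) ^ 2 + 2 * √L + 1 := by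
  have h1 : 1 ≤ √L := Real.one_le_sqrt.2 hL
  have h2 := Nat.floor_le (Real.sqrt_nonneg L)
  have h3 := Nat.lt_floor_add_one (√L)
  have h4 := Real.sq_sqrt (zero_le_one.trans hL)
  have h0 : (0 : ℝ) ≤ ⌊√L⌋₊ := Nat.cast_nonneg _
  exact ⟨(Nat.floor_pos.2 h1).ne', h2, by nlinarith, by nlinarith, by nlinarith⟩

/-- If the exponent is at least `x` at `⌊√L⌋`, then so is the normalised rate at scale `L`. -/
theorem sub_mul_le_gridRate_floor {x ε : ℝ} (hD : 0 < D) (hx : 0 ≤ x) (hxD : x ≤ D) (hL : 1 ≤ L)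
    (hK : 3 * D * (√L + 1) ≤ ε * L) (hc : x ≤ c ⌊√L⌋₊) :
    (x - ε) * L ≤ gridRate D (fun n => c n / D) ⌊√L⌋₊ L - D * ⌊√L⌋₊ := by
  obtain ⟨_, h1, h2, _, h3⟩ := floor_sqrt_bounds hL
  rw [gridRate_div_of_le hD h2]
  have h4 := mul_le_mul_of_nonneg_right hc (sq_nonneg (⌊√L⌋₊ : ℝ))
  have h5 := mul_le_mul_of_nonneg_left h3 hx
  have h6 := mul_le_mul_of_nonneg_left h1 hD.le
  have h7 : x * (2 * √L + 1) ≤ D * (2 * √L + 1) :=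
    mul_le_mul_of_nonneg_right hxD (by positivity)
  linarith

end Rate

theorem isGridExponent_const {D h t : ℝ} (hD : 0 < D) (ht : 0 ≤ t) (htD : t ≤ D) :
    IsGridExponent D h t t (max h t) fun _ => t / D := by
  have e : D * (t / D) = t := mul_div_cancel₀ _ hD.ne'
  have hlow : ∀ ε > 0, ∀ᶠ L : ℝ in atTop, ∃ n ≠ 0,
      (t - ε) * L ≤ gridRate D (fun _ => t / D) n L - D * n := fun ε hε => by
    filter_upwards [eventually_mul_sqrt_le (3 * D) hε, eventually_ge_atTop 1] with L h1 h2
    exact ⟨_, (floor_sqrt_bounds h2).1,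
      sub_mul_le_gridRate_floor (c := fun _ => t) hD ht htD h2 h1 le_rfl⟩
  refine ⟨fun _ => by positivity, fun _ => e.le, hlow, fun ε hε => (hlow ε hε).frequently,
    fun ε hε => Eventually.frequently ?_, fun ε hε => ?_, fun ε hε => Eventually.frequently ?_⟩
  · filter_upwards [eventually_ge_atTop 0] with L hL n _
    refine (gridRate_le_mul (a := fun _ => t / D) htD n e.le ht L).trans ?_
    gcongr
    linarith
  · rcases le_total t h with hth | hth
    · filter_upwards [eventually_ge_atTop (2 * D / ε), eventually_ge_atTop 0] with L h1 h2
      refine ⟨1, one_ne_zero, 0, ⟨le_rfl, h2⟩, ?_⟩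
      rw [div_le_iff₀ hε] at h1
      rw [max_eq_left hth, gridRate_div_of_ge hD (c := fun _ => t) (by simp)]
      push_cast
      linarith
    · filter_upwards [hlow ε hε, eventually_ge_atTop 0] with L ⟨n, hn, h1⟩ h2
      refine ⟨n, hn, L, ⟨h2, le_rfl⟩, ?_⟩
      rw [max_eq_right hth]
      linarith
  · filter_upwards [eventually_ge_atTop 0] with L hL n _ L' hL'
    have h1 := gridRate_le_mul (a := fun _ => t / D) htD n e.le ht L'
    have h2 := mul_le_mul_of_nonneg_right (le_max_right h t) hL'.1
    have h3 := mul_le_mul_of_nonneg_right (le_max_left h t) (sub_nonneg.2 hL'.2)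
    nlinarith [mul_nonneg hε.le hL]

/-! ### The exponent with peaks and gaps realises the prescribed rates -/

section Attained

variable {D h s t b : ℝ} {κ : ℕ → ℝ}

theorem tendsto_peak_atTop : Tendsto (fun k => (peak k : ℝ)) atTop atTop :=
  tendsto_natCast_atTop_atTop.comp peak_strictMono.tendsto_atTop

theorem eventually_of_lt_peak {P : ℕ → Prop} (hP : ∀ᶠ k in atTop, P k) :
    ∀ᶠ L : ℝ in atTop, ∀ k, ⌊√L⌋₊ < peak (k + 1) → P k := by
  obtain ⟨k₀, hk₀⟩ := eventually_atTop.1 hP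
  have h1 : Tendsto (fun L : ℝ => ⌊√L⌋₊) atTop atTop :=
    tendsto_nat_floor_atTop.comp Real.tendsto_sqrt_atTop
  filter_upwards [h1.eventually_ge_atTop (peak k₀)] with L hL k hk
  exact hk₀ k (Nat.lt_succ_iff.1 (peak_strictMono.lt_iff_lt.1 (hL.trans_lt hk)))

theorem frequently_of_eventually_peak {P : ℝ → Prop} {f : ℕ → ℝ} {C : ℝ} (hC : 0 < C)
    (hf : ∀ k, C * (peak k : ℝ) ^ 2 ≤ f k) (hP : ∀ᶠ k in atTop, P (f k)) :
    ∃ᶠ L : ℝ in atTop, P L := by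
  have h1 : Tendsto f atTop atTop := tendsto_atTop_mono hf
    (((tendsto_pow_atTop two_ne_zero).comp tendsto_peak_atTop).const_mul_atTop hC)
  exact h1.frequently hP.frequently

theorem eventually_const_le_mul (C : ℝ) {ε : ℝ} (hε : 0 < ε) :
    ∀ᶠ k : ℕ in atTop, C ≤ ε * (k + 1) := by
  filter_upwards [tendsto_natCast_atTop_atTop.eventually_ge_atTop (C / ε)] with k hk
  rw [div_le_iff₀ hε] at hk
  linarith

/-- At late peaks, the exponent is close to `t`. -/
theorem eventually_sub_mul_le_peak (hb : 0 ≤ b) {ε : ℝ} (hε : 0 < ε) :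
    ∀ᶠ k in atTop, (t - ε) * (peak k : ℝ) ^ 2 ≤
      peakHeight D t b k * (peak k : ℝ) ^ 2 - D * peak k := by
  filter_upwards [eventually_const_le_mul D (half_pos hε),
    tendsto_peak_atTop.eventually_ge_atTop (2 * D / ε)] with k h1 h2
  have h3 := le_peakHeight_add (D := D) (t := t) hb k
  have h4 : D / ((k : ℝ) + 1) ≤ ε / 2 := by rwa [div_le_iff₀ (by positivity)]
  rw [div_le_iff₀ hε] at h2
  have h5 : (0 : ℝ) ≤ peak k := Nat.cast_nonneg _
  nlinarith [mul_le_mul_of_nonneg_right h2 h5,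
    mul_le_mul_of_nonneg_right (h3.trans (add_le_add_right h4 _)) (sq_nonneg (peak k : ℝ))]

theorem le_peakExponent_or {n : ℕ} (hn : n ≠ 0) : b ≤ peakExponent D t b κ n ∨
    ∃ k, peak k < n ∧ n < peak (k + 1) ∧ (n : ℝ) ^ 2 < κ k * (peak k : ℝ) ^ 2 := by
  rcases peak_cases hn with ⟨k, rfl⟩ | ⟨k, h1, h2⟩
  · exact Or.inl (peakExponent_peak (D := D) (t := t) (b := b) (κ := κ) k ▸ le_peakHeight k)
  · rcases lt_or_ge ((n : ℝ) ^ 2) (κ k * (peak k : ℝ) ^ 2) with h3 | h3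
    · exact Or.inr ⟨k, h1, h2, h3⟩
    · exact Or.inl (peakExponent_of_le h1 h2 h3).ge

theorem gridRate_peak_of_le (hD : 0 < D) {k : ℕ} {L : ℝ} (hL : (peak k : ℝ) ^ 2 ≤ L) :
    gridRate D (fun n => peakExponent D t b κ n / D) (peak k) L =
      peakHeight D t b k * (peak k : ℝ) ^ 2 := by
  rw [gridRate_div_of_le hD hL, peakExponent_peak]

theorem gridRate_peak_le (hD : 0 < D) (ht : 0 ≤ t) (hbt : b ≤ t) (hbD : b ≤ D) {j k : ℕ}
    (hjk : j ≤ k) (L : ℝ) :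
    gridRate D (fun n => peakExponent D t b κ n / D) (peak j) L ≤ t * (peak k : ℝ) ^ 2 := by
  refine (gridRate_div_le hD).trans ?_
  rw [peakExponent_peak]
  have h1 : (peak j : ℝ) ≤ peak k := Nat.cast_le.2 (peak_strictMono.monotone hjk)
  have h2 := peakHeight_le hbt hbD j
  gcongr

/-- Later peaks contribute nothing at scales attached to earlier peaks. -/
theorem eventually_gridRate_peak_nonpos (hD : 0 < D) (htD : t ≤ D) (hbD : b < D) :
    ∀ᶠ k in atTop, ∀ j > k, ∀ L ≤ (k + 2) * (peak k : ℝ) ^ 2,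
      gridRate D (fun n => peakExponent D t b κ n / D) (peak j) L ≤ 0 := by
  filter_upwards [eventually_mul_sq_peak_le htD hbD] with k hk j hj L hL
  refine (gridRate_div_le' hD).trans ?_
  rw [peakExponent_peak]
  linarith [hk j hj, mul_le_mul_of_nonneg_left hL hD.le]

/-- If the `k`-th peak contributes too little at scale `L`, then the gap after it has ended soon
after `L`. -/
theorem mul_mul_sq_peak_le_of_lt (hD : 0 < D) (hs : 0 < s) (hsb : s ≤ b) (hbD : b < D)
    {k : ℕ} {L ε : ℝ} (hsκ : s * (t + (D - b) * κ k) ≤ t * D)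
    (hL : peakHeight D t b k * (peak k : ℝ) ^ 2 ≤ s * L) (hNL : (peak k : ℝ) ^ 2 ≤ L)
    (hk : D ^ 2 ≤ ε / 2 * s * (k + 1)) :
    (D - b) * (κ k * (peak k : ℝ) ^ 2) ≤ (D - s + ε / 2) * L := by
  have hL0 : 0 ≤ L := (sq_nonneg _).trans hNL
  have hDs : 0 ≤ D - s := by linarith
  refine le_of_mul_le_mul_left ?_ hs
  have h5 : t * (peak k : ℝ) ^ 2 ≤ s * L + D / (k + 1) * L := by
    have h6 := mul_le_mul_of_nonneg_right
      (le_peakHeight_add (D := D) (t := t) (hs.le.trans hsb) k) (sq_nonneg (peak k : ℝ))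
    have h7 : D / (k + 1) * (peak k : ℝ) ^ 2 ≤ D / (k + 1) * L := by gcongr
    linarith
  have h6 : D * (D / (k + 1)) ≤ ε / 2 * s := by
    rw [← mul_div_assoc, div_le_iff₀ (by positivity)]
    linarith
  have h7 : 0 ≤ D / ((k : ℝ) + 1) := by positivity
  calc s * ((D - b) * (κ k * (peak k : ℝ) ^ 2))
      = s * ((D - b) * κ k) * (peak k : ℝ) ^ 2 := by ring
    _ ≤ t * (D - s) * (peak k : ℝ) ^ 2 :=
      mul_le_mul_of_nonneg_right (by linarith) (sq_nonneg _)
    _ = (D - s) * (t * (peak k : ℝ) ^ 2) := by ring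
    _ ≤ (D - s) * (s * L + D / (k + 1) * L) := by gcongr
    _ = s * (D - s) * L + (D - s) * (D / (k + 1)) * L := by ring
    _ ≤ s * (D - s) * L + D * (D / (k + 1)) * L := by gcongr; linarith
    _ ≤ s * (D - s) * L + ε / 2 * s * L := by gcongr
    _ = s * ((D - s + ε / 2) * L) := by ring

/-- Just after the gap following the `k`-th peak, the exponent is `b`. -/
theorem exists_peakExponent_eq {k m : ℕ} (hκ : 0 ≤ κ k) (hκ' : κ k ≤ k + 1) (hm : peak k < m)
    (hmκ : (m : ℝ) ^ 2 < κ k * (peak k : ℝ) ^ 2) :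
    ∃ n, m + 1 ≤ n ∧ peakExponent D t b κ n = b ∧ (n : ℝ) ≤ √(κ k) * peak k + 1 := by
  have hN0 : (0 : ℝ) ≤ peak k := Nat.cast_nonneg _
  have hk0 : (0 : ℝ) ≤ k := k.cast_nonneg
  set Y := √(κ k) * peak k with hY
  have hY0 : 0 ≤ Y := by positivity
  have hY2 : Y ^ 2 = κ k * (peak k : ℝ) ^ 2 := by rw [hY, mul_pow, Real.sq_sqrt hκ]
  have hc₁ := Nat.le_ceil Y
  have hc₂ := Nat.ceil_lt_add_one hY0
  have hYn : (m : ℝ) < Y := lt_of_pow_lt_pow_left₀ 2 hY0 (hY2 ▸ hmκ)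
  have hnc : m + 1 ≤ ⌈Y⌉₊ := by
    rw [Nat.succ_le_iff, ← Nat.cast_lt (α := ℝ)]
    exact hYn.trans_le hc₁
  have hκk : √(κ k) ≤ k + 1 := by
    rw [Real.sqrt_le_left (by positivity)]
    nlinarith
  have hcp : ⌈Y⌉₊ < peak (k + 1) := by
    rw [← Nat.cast_lt (α := ℝ)]
    have h5 : 2 * ((k : ℝ) + 1) ^ 2 * peak k ≤ peak (k + 1) := by
      exact_mod_cast two_mul_sq_mul_peak_le k
    have h6 : (1 : ℝ) ≤ peak k := by exact_mod_cast peak_pos k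
    have h7 : Y ≤ (k + 1) * peak k := mul_le_mul_of_nonneg_right hκk hN0
    have h8 : ((k : ℝ) + 1) * peak k ≤ ((k : ℝ) + 1) ^ 2 * peak k :=
      mul_le_mul_of_nonneg_right (by nlinarith) hN0
    have h9 : 1 * (peak k : ℝ) ≤ ((k : ℝ) + 1) ^ 2 * peak k :=
      mul_le_mul_of_nonneg_right (by nlinarith) hN0
    linarith
  exact ⟨⌈Y⌉₊, hnc, peakExponent_of_le (by omega) hcp (hY2 ▸ pow_le_pow_left₀ hY0 hc₁ 2), hc₂.le⟩

theorem eventually_le_gridRate_peakExponent (hD : 0 < D) (hs : 0 ≤ s) (hsb : s ≤ b) (hbt : b ≤ t)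
    (hbD : b < D) (hκ : ∀ k, 1 ≤ κ k) (hκ' : ∀ k, κ k ≤ k + 1)
    (hsκ : ∀ k, s * (t + (D - b) * κ k) ≤ t * D) {ε : ℝ} (hε : 0 < ε) :
    ∀ᶠ L : ℝ in atTop, ∃ n ≠ 0,
      (s - ε) * L ≤ gridRate D (fun n => peakExponent D t b κ n / D) n L - D * n := by
  set M := t * D / (s * (D - b)) with hM
  have hDb : 0 < D - b := sub_pos.2 hbD
  have hk₁ : ∀ᶠ k : ℕ in atTop, 0 < s → D ^ 2 ≤ ε / 2 * s * (k + 1) := by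
    rcases hs.eq_or_lt with h | h
    · exact Eventually.of_forall fun _ h' => absurd h h'.ne
    · filter_upwards [eventually_const_le_mul (D ^ 2) (by positivity : 0 < ε / 2 * s)] with k hk _
      exact hk
  filter_upwards [eventually_ge_atTop 1, eventually_mul_sqrt_le (3 * D) hε,
    eventually_mul_sqrt_le (3 * D * (√M + 1)) (half_pos hε), eventually_of_lt_peak hk₁]
    with L hL hL₁ hL₂ hL₃
  obtain ⟨hn, hn₁, hn₂, hn₃, -⟩ := floor_sqrt_bounds hL
  have hL0 : 0 < L := by linarith
  have hL₄ := Real.sq_sqrt hL0.le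
  have hL₅ := Real.sqrt_nonneg L
  rcases le_peakExponent_or (D := D) (t := t) (b := b) (κ := κ) hn with h1 | ⟨k, h1, h2, h3⟩
  · exact ⟨_, hn, sub_mul_le_gridRate_floor hD hs (hsb.trans hbD.le) hL hL₁ (hsb.trans h1)⟩
  have hN : (peak k : ℝ) ≤ √L := (Nat.cast_le.2 h1.le).trans hn₁
  have hN0 : (0 : ℝ) ≤ peak k := Nat.cast_nonneg _
  have hNL : (peak k : ℝ) ^ 2 ≤ L := by nlinarith
  have hκ0 : 0 ≤ κ k := zero_le_one.trans (hκ k)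
  by_cases h4 : s * L ≤ peakHeight D t b k * (peak k : ℝ) ^ 2
  · refine ⟨peak k, (peak_pos k).ne', ?_⟩
    rw [gridRate_peak_of_le hD hNL]
    nlinarith
  push Not at h4
  have hs0 : 0 < s := by
    refine pos_of_mul_pos_left (lt_of_le_of_lt ?_ h4) hL0.le
    exact mul_nonneg ((hs.trans hsb).trans (le_peakHeight k)) (sq_nonneg _)
  have hsD : s ≤ D := hsb.trans hbD.le
  have hk := hL₃ k h2 hs0
  obtain ⟨n, hn₄, hval, hnY⟩ :=
    exists_peakExponent_eq (D := D) (t := t) (b := b) hκ0 (hκ' k) h1 h3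
  set Y := √(κ k) * peak k with hY
  have hY0 : 0 ≤ Y := by positivity
  have hY2 : Y ^ 2 = κ k * (peak k : ℝ) ^ 2 := by rw [hY, mul_pow, Real.sq_sqrt hκ0]
  have hLn : L ≤ (n : ℝ) ^ 2 := by
    have : ((⌊√L⌋₊ : ℝ) + 1) ≤ n := by exact_mod_cast hn₄
    exact hn₃.le.trans (pow_le_pow_left₀ (by positivity) this 2)
  refine ⟨n, by omega, ?_⟩
  rw [gridRate_div_of_ge hD hLn, hval]
  have hYM : Y ≤ √M * √L := by
    have h5 : κ k ≤ M := by
      rw [hM, le_div_iff₀ (by positivity)]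
      nlinarith [hsκ k, mul_nonneg hs (hs.trans (hsb.trans hbt))]
    exact mul_le_mul (Real.sqrt_le_sqrt h5) hN hN0 (Real.sqrt_nonneg _)
  have hYb : (D - b) * (κ k * (peak k : ℝ) ^ 2) ≤ (D - s + ε / 2) * L :=
    mul_mul_sq_peak_le_of_lt hD hs0 hsb hbD (hsκ k) h4.le hNL hk
  rw [← hY2] at hYb
  have hn₅ : (n : ℝ) ^ 2 ≤ Y ^ 2 + 2 * Y + 1 := by
    have := pow_le_pow_left₀ n.cast_nonneg hnY 2
    linarith
  have hn₆ := mul_le_mul_of_nonneg_left hn₅ hDb.le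
  have hb0 : 0 ≤ b := hs.trans hsb
  have hn₇ : (D - b) * (2 * Y + 1) ≤ D * (2 * Y + 1) := by gcongr; linarith
  have hn₈ : D * (3 * Y + 2) ≤ 3 * D * (√M + 1) * (√L + 1) := by
    linarith [mul_le_mul_of_nonneg_left hYM hD.le, mul_nonneg hD.le (Real.sqrt_nonneg M),
      mul_nonneg hD.le hL₅]
  linarith [mul_le_mul_of_nonneg_left hnY hD.le]

theorem frequently_gridRate_peakExponent_ge (hD : 0 < D) (hb : 0 ≤ b) {ε : ℝ} (hε : 0 < ε) :
    ∃ᶠ L : ℝ in atTop, ∃ n ≠ 0,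
      (t - ε) * L ≤ gridRate D (fun n => peakExponent D t b κ n / D) n L - D * n := by
  refine frequently_of_eventually_peak one_pos (fun k => (one_mul _).le) ?_
  filter_upwards [eventually_sub_mul_le_peak (D := D) (t := t) hb hε] with k hk
  exact ⟨peak k, (peak_pos k).ne', by rwa [gridRate_peak_of_le hD le_rfl]⟩

theorem frequently_gridRate_peakExponent_le (hD : 0 < D) (hb : 0 ≤ b) (hbt : b ≤ t)
    (htD : t ≤ D) (hbD : b < D) (hκ' : ∀ k, κ k ≤ k + 1) {σ : ℝ}
    (hσ : ∀ᶠ k in atTop, t * D ≤ σ * (t + (D - b) * κ k)) (hκ₀ : ∀ k, 1 ≤ κ k) :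
    ∃ᶠ L : ℝ in atTop, ∀ n ≠ 0,
      gridRate D (fun n => peakExponent D t b κ n / D) n L ≤ σ * L := by
  have hDb : 0 < D - b := sub_pos.2 hbD
  have ht : 0 ≤ t := hb.trans hbt
  refine frequently_of_eventually_peak (f := fun k => (t + (D - b) * κ k) * (peak k : ℝ) ^ 2 / D)
    (div_pos hDb hD) (fun k => ?_) ?_
  · rw [div_mul_eq_mul_div]
    gcongr
    nlinarith [hκ₀ k]
  filter_upwards [hσ, eventually_gridRate_peak_nonpos (κ := κ) hD htD hbD] with k h1 h2 n hn
  set L := (t + (D - b) * κ k) * (peak k : ℝ) ^ 2 / D with hL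
  have hDL : D * L = (t + (D - b) * κ k) * (peak k : ℝ) ^ 2 := by
    rw [hL, mul_div_cancel₀ _ hD.ne']
  have hN := sq_nonneg (peak k : ℝ)
  suffices h3 : gridRate D (fun n => peakExponent D t b κ n / D) n L ≤ t * (peak k : ℝ) ^ 2 by
    refine h3.trans (le_of_mul_le_mul_left ?_ hD)
    calc D * (t * (peak k : ℝ) ^ 2) = t * D * (peak k : ℝ) ^ 2 := by ring
      _ ≤ σ * (t + (D - b) * κ k) * (peak k : ℝ) ^ 2 := by gcongr
      _ = σ * (D * L) := by rw [hDL]; ring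
      _ = D * (σ * L) := by ring
  rcases peak_cases hn with ⟨j, rfl⟩ | ⟨j, h3, h4⟩
  · rcases le_or_gt j k with hjk | hjk
    · exact gridRate_peak_le hD ht hbt hbD.le hjk L
    · refine (h2 j hjk L ?_).trans (by positivity)
      refine le_of_mul_le_mul_left ?_ hD
      rw [hDL, ← mul_assoc]
      gcongr
      nlinarith [hκ' k, mul_le_mul_of_nonneg_left (hκ' k) hDb.le,
        mul_nonneg hb (by positivity : (0 : ℝ) ≤ k + 1)]
  rcases lt_or_ge ((n : ℝ) ^ 2) (κ j * (peak j : ℝ) ^ 2) with h5 | h5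
  · refine (gridRate_div_le hD).trans ?_
    rw [peakExponent_of_lt h3 h4 h5, zero_mul]
    positivity
  have h6 := peakExponent_of_le (D := D) (t := t) (b := b) h3 h4 h5
  rcases le_or_gt n (peak k) with h7 | h7
  · refine (gridRate_div_le hD).trans ?_
    rw [h6]
    have : (n : ℝ) ≤ peak k := Nat.cast_le.2 h7
    gcongr
  refine (gridRate_div_le' hD).trans ?_
  rw [h6, hDL]
  suffices h8 : κ k * (peak k : ℝ) ^ 2 ≤ (n : ℝ) ^ 2 by
    linarith [mul_le_mul_of_nonneg_left h8 hDb.le]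
  have hkj : k ≤ j := Nat.lt_succ_iff.1 (peak_strictMono.lt_iff_lt.1 (h7.trans h4))
  rcases hkj.eq_or_lt with rfl | hkj
  · exact h5
  have h8 : (peak (k + 1) : ℝ) ≤ n := Nat.cast_le.2 ((peak_strictMono.monotone hkj).trans h3.le)
  have h9 : 2 * ((k : ℝ) + 1) ^ 2 * peak k ≤ peak (k + 1) := by
    exact_mod_cast two_mul_sq_mul_peak_le k
  have hk0 : (0 : ℝ) ≤ k := k.cast_nonneg
  calc κ k * (peak k : ℝ) ^ 2 ≤ (2 * ((k : ℝ) + 1) ^ 2) ^ 2 * (peak k : ℝ) ^ 2 := by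
        gcongr
        refine (hκ' k).trans ((by nlinarith : (k : ℝ) + 1 ≤ 2 * (k + 1) ^ 2).trans ?_)
        exact le_self_pow₀ (by nlinarith) two_ne_zero
    _ = (2 * ((k : ℝ) + 1) ^ 2 * peak k) ^ 2 := by ring
    _ ≤ (n : ℝ) ^ 2 := pow_le_pow_left₀ (by positivity) (h9.trans h8) 2

theorem eventually_le_max_gridRate_peakExponent (hD : 0 < D) (hb : 0 ≤ b) (hbD : b < D)
    (hh : 0 ≤ h) (hhb : h ≤ b) (hbκ : ∀ k, (b - h) * κ k ≤ t - h) {ε : ℝ} (hε : 0 < ε) :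
    ∀ᶠ L : ℝ in atTop, ∃ n ≠ 0, ∃ L' ∈ Icc 0 L, (b - ε) * L ≤
      gridRate D (fun n => peakExponent D t b κ n / D) n L' + h * (L - L') - D * n := by
  filter_upwards [eventually_ge_atTop 1, eventually_mul_sqrt_le (3 * D) hε,
    eventually_mul_sqrt_le (2 * D) (half_pos hε),
    eventually_of_lt_peak (eventually_sub_mul_le_peak (D := D) (t := t) hb (half_pos hε))]
    with L hL hL₁ hL₂ hL₃
  obtain ⟨hn, hn₁, hn₂, -, hn₃⟩ := floor_sqrt_bounds hL
  have hL0 : 0 < L := by linarith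
  have hL₅ := Real.sqrt_nonneg L
  rcases le_peakExponent_or (D := D) (t := t) (b := b) (κ := κ) hn with h1 | ⟨k, h1, h2, h3⟩
  · refine ⟨_, hn, L, ⟨hL0.le, le_rfl⟩, ?_⟩
    have := sub_mul_le_gridRate_floor hD hb hbD.le hL hL₁ h1
    linarith
  have hNL : (peak k : ℝ) ^ 2 ≤ L :=
    (pow_le_pow_left₀ (Nat.cast_nonneg _) (Nat.cast_le.2 h1.le) 2).trans hn₂
  refine ⟨peak k, (peak_pos k).ne', (peak k : ℝ) ^ 2, ⟨sq_nonneg _, hNL⟩, ?_⟩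
  rw [gridRate_peak_of_le hD le_rfl]
  have h4 := hL₃ k h2
  have h5 : L ≤ κ k * (peak k : ℝ) ^ 2 + (2 * √L + 1) := by linarith
  have h6 := mul_le_mul_of_nonneg_left h5 (sub_nonneg.2 hhb)
  have h7 := mul_le_mul_of_nonneg_right (hbκ k) (sq_nonneg (peak k : ℝ))
  have h8 : (b - h) * (2 * √L + 1) ≤ D * (2 * √L + 1) := by gcongr; linarith
  nlinarith [mul_le_mul_of_nonneg_left hNL hε.le]

theorem frequently_max_gridRate_peakExponent_le (hD : 0 < D) (hb : 0 ≤ b) (hbt : b ≤ t)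
    (htD : t ≤ D) (hbD : b < D) (hhb : h ≤ b) {ε : ℝ} (hε : 0 < ε) :
    ∃ᶠ L : ℝ in atTop, ∀ n ≠ 0, ∀ L' ∈ Icc 0 L,
      gridRate D (fun n => peakExponent D t b κ n / D) n L' + h * (L - L') ≤ (b + ε) * L := by
  have ht : 0 ≤ t := hb.trans hbt
  refine frequently_of_eventually_peak (f := fun k => (k + 1) * (peak k : ℝ) ^ 2)
    one_pos (fun k => ?_) ?_
  · gcongr
    linarith [(k.cast_nonneg : (0 : ℝ) ≤ k)]
  filter_upwards [eventually_const_le_mul t hε,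
    eventually_gridRate_peak_nonpos (κ := κ) hD htD hbD] with k h1 h2 n hn L' hL'
  set L := (k + 1) * (peak k : ℝ) ^ 2 with hL
  have hL0 : 0 ≤ L := hL'.1.trans hL'.2
  have h3 : h * (L - L') ≤ b * (L - L') :=
    mul_le_mul_of_nonneg_right hhb (sub_nonneg.2 hL'.2)
  have h4 : 0 ≤ b * L' := mul_nonneg hb hL'.1
  have hbase : gridRate D (fun n => peakExponent D t b κ n / D) n L' ≤ b * L' →
      gridRate D (fun n => peakExponent D t b κ n / D) n L' + h * (L - L') ≤ (b + ε) * L :=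
    fun h => by linarith [mul_nonneg hε.le hL0]
  rcases peak_cases hn with ⟨j, rfl⟩ | ⟨j, h5, h6⟩
  · rcases le_or_gt j k with hjk | hjk
    · have h7 := gridRate_peak_le (κ := κ) hD ht hbt hbD.le hjk L'
      have h8 : t * (peak k : ℝ) ^ 2 ≤ ε * L := by
        rw [hL, ← mul_assoc]
        gcongr
      linarith
    · refine hbase ((h2 j hjk L' (hL'.2.trans ?_)).trans h4)
      rw [hL]
      gcongr
      norm_num
  · refine hbase (gridRate_le_mul hbD.le n ?_ hb L')
    rw [mul_div_cancel₀ _ hD.ne']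
    rcases lt_or_ge ((n : ℝ) ^ 2) (κ j * (peak j : ℝ) ^ 2) with h7 | h7
    · rwa [peakExponent_of_lt h5 h6 h7]
    · rw [peakExponent_of_le h5 h6 h7]

/-- If `t ≤ h`, the truncated rates are governed by `h` alone. -/
theorem isGridExponent_peakExponent_of_le (hD : 0 < D) (hs : 0 ≤ s) (hsb : s ≤ b) (hbt : b ≤ t)
    (htD : t ≤ D) (hbD : b < D) (hκ : ∀ k, 1 ≤ κ k) (hκ' : ∀ k, κ k ≤ k + 1)
    (hsκ : ∀ k, s * (t + (D - b) * κ k) ≤ t * D)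
    (hsκ' : ∀ ε > 0, ∀ᶠ k in atTop, t * D ≤ (s + ε) * (t + (D - b) * κ k)) (hth : t ≤ h) :
    IsGridExponent D h s t h fun n => peakExponent D t b κ n / D := by
  have hb : 0 ≤ b := hs.trans hsb
  have hle : ∀ n, D * (peakExponent D t b κ n / D) ≤ t := fun n => by
    rw [mul_div_cancel₀ _ hD.ne']
    exact peakExponent_le hb hbt hbD.le n
  refine ⟨fun n => div_nonneg (peakExponent_nonneg hb n) hD.le, hle,
    fun ε hε => eventually_le_gridRate_peakExponent hD hs hsb hbt hbD hκ hκ' hsκ hε,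
    fun ε hε => frequently_gridRate_peakExponent_ge hD hb hε,
    fun ε hε => frequently_gridRate_peakExponent_le hD hb hbt htD hbD hκ' (hsκ' ε hε) hκ, fun ε hε => ?_,
    fun ε hε => Eventually.frequently ?_⟩
  · filter_upwards [eventually_ge_atTop (2 * D / ε), eventually_ge_atTop 0] with L h1 h2
    refine ⟨1, one_ne_zero, 0, ⟨le_rfl, h2⟩, ?_⟩
    rw [div_le_iff₀ hε] at h1
    rw [gridRate_div_of_ge hD (by simp)]
    have := peakExponent_nonneg (D := D) (t := t) (κ := κ) hb 1
    push_cast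
    linarith
  · filter_upwards [eventually_ge_atTop 0] with L hL n _ L' hL'
    have h1 := gridRate_le_mul (a := fun n => peakExponent D t b κ n / D) htD n (hle n) (hb.trans hbt) L'
    have h2 := mul_le_mul_of_nonneg_right hth hL'.1
    linarith [mul_nonneg hε.le hL]

theorem isGridExponent_peakExponent (hD : 0 < D) (hs : 0 ≤ s) (hsb : s ≤ b) (hbt : b ≤ t)
    (htD : t ≤ D) (hbD : b < D) (hκ : ∀ k, 1 ≤ κ k) (hκ' : ∀ k, κ k ≤ k + 1)
    (hsκ : ∀ k, s * (t + (D - b) * κ k) ≤ t * D)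
    (hsκ' : ∀ ε > 0, ∀ᶠ k in atTop, t * D ≤ (s + ε) * (t + (D - b) * κ k))
    (hh : 0 ≤ h) (hhb : h ≤ b) (hbκ : ∀ k, (b - h) * κ k ≤ t - h) :
    IsGridExponent D h s t b fun n => peakExponent D t b κ n / D := by
  have hb : 0 ≤ b := hs.trans hsb
  refine ⟨fun n => div_nonneg (peakExponent_nonneg hb n) hD.le, fun n => ?_,
    fun ε hε => eventually_le_gridRate_peakExponent hD hs hsb hbt hbD hκ hκ' hsκ hε,
    fun ε hε => frequently_gridRate_peakExponent_ge hD hb hε,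
    fun ε hε => frequently_gridRate_peakExponent_le hD hb hbt htD hbD hκ' (hsκ' ε hε) hκ,
    fun ε hε => eventually_le_max_gridRate_peakExponent hD hb hbD hh hhb hbκ hε,
    fun ε hε => frequently_max_gridRate_peakExponent_le hD hb hbt htD hbD hhb hε⟩
  rw [mul_div_cancel₀ _ hD.ne']
  exact peakExponent_le hb hbt hbD.le n

/-- The gap lengths for which the lower rate is `s`. -/
theorem exists_gap_ratio (hD : 0 < D) (hs : 0 ≤ s) (hsb : s ≤ b) (hbt : b ≤ t) (hst : s < t)
    (hbD : b < D) :
    ∃ κ : ℕ → ℝ, (∀ k, 1 ≤ κ k) ∧ (∀ k, κ k ≤ k + 1) ∧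
      (∀ k, s * (t + (D - b) * κ k) ≤ t * D) ∧
      (∀ ε > 0, ∀ᶠ k in atTop, t * D ≤ (s + ε) * (t + (D - b) * κ k)) ∧
      ∀ h, h ≤ b → (b - h) * (t * (D - s)) ≤ (t - h) * (s * (D - b)) →
        ∀ k, (b - h) * κ k ≤ t - h := by
  have hDb : 0 < D - b := sub_pos.2 hbD
  have ht : 0 < t := hs.trans_lt hst
  rcases hs.eq_or_lt with rfl | hs
  · refine ⟨fun k => k + 1, fun k => by simp, fun k => le_rfl, fun k => ?_, fun ε hε => ?_,
      fun h hh h1 k => ?_⟩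
    · rw [zero_mul]
      positivity
    · filter_upwards [eventually_const_le_mul (t * D) (mul_pos hε hDb)] with k hk
      linarith [mul_pos hε ht]
    · have h2 : (b - h) * (t * D) ≤ 0 := by linarith
      have h3 : b - h ≤ 0 := nonpos_of_mul_nonpos_left h2 (mul_pos ht hD)
      nlinarith [(k.cast_nonneg : (0 : ℝ) ≤ k)]
  · have hsD : 0 < s * (D - b) := mul_pos hs hDb
    have hM : s * (D - b) * (t * (D - s) / (s * (D - b))) = t * (D - s) :=
      mul_div_cancel₀ _ hsD.ne'
    set M := t * (D - s) / (s * (D - b))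
    refine ⟨fun k => min (k + 1) M, fun k => le_min (by simp) ?_, fun k => min_le_left _ _,
      fun k => ?_, fun ε hε => ?_, fun h hh h1 k => ?_⟩
    · refine le_of_mul_le_mul_left ?_ hsD
      nlinarith
    · have := mul_le_mul_of_nonneg_left (min_le_right ((k : ℝ) + 1) M) hsD.le
      linarith
    · filter_upwards [tendsto_natCast_atTop_atTop.eventually_ge_atTop M] with k hk
      rw [min_eq_right (by linarith)]
      have hM0 : 0 ≤ M := div_nonneg (mul_nonneg ht.le (by linarith)) hsD.le
      nlinarith [mul_pos hε ht, mul_nonneg hε.le (mul_nonneg hDb.le hM0)]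
    · refine (mul_le_mul_of_nonneg_left (min_le_right _ _) (sub_nonneg.2 hh)).trans ?_
      refine le_of_mul_le_mul_left ?_ hsD
      rw [mul_left_comm, hM]
      linarith

/-- Every admissible value is attained by some sequence of exponents. -/
theorem exists_isGridExponent {β : ℝ} (hh : 0 < h) (hhD : h < D) (hs : 0 ≤ s) (hst : s ≤ t)
    (htD : t ≤ D) (hβ : β ∈ Dset h s t D) : ∃ a, IsGridExponent D h s t β a ∧ h ≤ β := by
  have hD : 0 < D := hh.trans hhD
  rw [Dset] at hβ
  split_ifs at hβ with hth
  · rw [mem_singleton_iff] at hβ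
    subst hβ
    rcases hst.eq_or_lt with rfl | hst
    · exact ⟨_, max_eq_left hth ▸ isGridExponent_const hD hs htD, le_rfl⟩
    · have htD' : t < D := hth.trans_lt hhD
      obtain ⟨κ, h1, h2, h3, h4, -⟩ := exists_gap_ratio hD hs hst.le le_rfl hst htD'
      exact ⟨_, isGridExponent_peakExponent_of_le hD hs hst.le le_rfl htD htD' h1 h2 h3 h4 hth,
        le_rfl⟩
  · push Not at hth
    obtain ⟨hβ₁, hβ₂⟩ := hβ
    have hhβ : h ≤ β := (le_max_left _ _).trans hβ₁
    have hsβ : s ≤ β := (le_max_right _ _).trans hβ₁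
    have hpos : 0 < D * t - h * s := by nlinarith
    have hβ₃ : (β - h) * (D * t - h * s) ≤ (t - h) * (D - h) * s := by
      rw [← le_div_iff₀ hpos]
      linarith
    rcases hst.eq_or_lt with rfl | hst
    · have hβs : β - h ≤ s - h := le_of_mul_le_mul_right (hβ₃.trans_eq (by ring)) hpos
      obtain rfl : s = β := hsβ.antisymm (sub_le_sub_iff_right h |>.1 hβs)
      exact ⟨_, max_eq_right hhβ ▸ isGridExponent_const hD hs htD, hhβ⟩
    · have hβt : β < t := by
        by_contra! hcon
        have h1 := mul_le_mul_of_nonneg_right (sub_le_sub_right hcon h) hpos.le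
        have h2 : 0 < (t - h) * (D * (t - s)) :=
          mul_pos (sub_pos.2 hth) (mul_pos hD (sub_pos.2 hst))
        linarith
      obtain ⟨κ, h1, h2, h3, h4, h5⟩ :=
        exists_gap_ratio hD hs hsβ hβt.le hst (hβt.trans_le htD)
      exact ⟨_, isGridExponent_peakExponent hD hs hsβ hβt.le htD (hβt.trans_le htD) h1 h2 h3 h4
        hh.le hhβ (h5 h hhβ (by linarith)), hhβ⟩

end Attained

/-- Sharpness: for every `0 < h < d`, `0 ≤ s ≤ t ≤ d` and
`β ∈ 𝒟(h,s,t,d)` there is a CIFS of contracting similarity maps on `ℝ^d` realising these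
values of `dim_H Λ`, `dim_LB F`, `dim_UB F` and `dim_LB Λ`. -/
theorem Dset_sharp {d : ℕ} (hd : 1 ≤ d) (h s t beta : ℝ)
    (hh0 : 0 < h) (hhd : h < d) (hs0 : 0 ≤ s) (hst : s ≤ t) (htd : t ≤ d)
    (hbeta : beta ∈ Dset h s t d) :
    ∃ Phi : CIFS d,
      (∀ i : Phi.I, ∃ r : ℝ, 0 < r ∧ r < 1 ∧
        ∀ x y, dist (Phi.S i x) (Phi.S i y) = r * dist x y) ∧
      (dimH Phi.limitSet).toReal = h ∧ dimLB Phi.fixedPoints = s ∧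
      dimUB Phi.fixedPoints = t ∧ dimLB Phi.limitSet = beta := by
  obtain ⟨_, ha, hhb⟩ := exists_isGridExponent hh0 hhd hs0 hst htd hbeta
  exact ha.exists_CIFS hd hh0 hhd hs0 hst htd hhb

end
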